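/- arXiv:2107.03477 — 18 statements merged into one kernel-verified Lean document; each statement's English description precedes it below -/
import Mathlib

section
/- There exists at least one lane choice equilibrium; that is, there exists a feasible flow f = (x, y, z) satisfying all six equilibrium conditions. -/
noncomputable section

/-- A feasible flow `f = (x, y, z)`: flows of (HV,LO), (HV,HO), (AV,LO) vehicles on lane 1. -/
def Feasible (dHL dHH dAL n : ℝ) (f : ℝ × ℝ × ℝ) : Prop :=
  0 ≤ f.1 ∧ f.1 ≤ dHL ∧ 0 ≤ f.2.1 ∧ f.2.1 ≤ dHH / n ∧ 0 ≤ f.2.2 ∧ f.2.2 ≤ dAL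

/-- Effective flow on lane 1. -/
def F1 (dAH n μ : ℝ) (f : ℝ × ℝ × ℝ) : ℝ :=
  f.1 + f.2.1 + μ * (f.2.2 + dAH / n)

/-- Theoretical minimum of the effective lane-1 flow. -/
def f1min (dAH n μ : ℝ) : ℝ := μ * dAH / n

/-- Theoretical maximum of the effective lane-1 flow. -/
def f1max (dHL dHH dAL dAH n μ : ℝ) : ℝ :=
  dHL + dHH / n + μ * (dAL + dAH / n)

/-- Lane choice (Wardrop) equilibrium under a uniform toll `τ`. -/
def IsEquilibrium (D1 D2 : ℝ → ℝ) (dHL dHH dAL dAH n μ τ : ℝ) (f : ℝ × ℝ × ℝ) : Prop :=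
  Feasible dHL dHH dAL n f ∧
  (0 < f.1 → D1 (F1 dAH n μ f) + τ ≤ D2 (f1max dHL dHH dAL dAH n μ - F1 dAH n μ f)) ∧
  (f.1 < dHL → D2 (f1max dHL dHH dAL dAH n μ - F1 dAH n μ f) ≤ D1 (F1 dAH n μ f) + τ) ∧
  (0 < f.2.1 → D1 (F1 dAH n μ f) + τ ≤ D2 (f1max dHL dHH dAL dAH n μ - F1 dAH n μ f)) ∧
  (f.2.1 < dHH / n → D2 (f1max dHL dHH dAL dAH n μ - F1 dAH n μ f) ≤ D1 (F1 dAH n μ f) + τ) ∧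
  (0 < f.2.2 → D1 (F1 dAH n μ f) + τ ≤ D2 (f1max dHL dHH dAL dAH n μ - F1 dAH n μ f)) ∧
  (f.2.2 < dAL → D2 (f1max dHL dHH dAL dAH n μ - F1 dAH n μ f) ≤ D1 (F1 dAH n μ f) + τ)

theorem equilibrium_exists
    (D1 D2 : ℝ → ℝ) (dHL dHH dAL dAH n μ : ℝ)
    (hdHL : 0 ≤ dHL) (hdHH : 0 ≤ dHH) (hdAL : 0 ≤ dAL) (hdAH : 0 ≤ dAH)
    (hn : 2 ≤ n) (hμ0 : 0 < μ) (hμ1 : μ < 1)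
    (hD1c : Continuous D1) (hD1m : StrictMono D1)
    (hD2c : Continuous D2) (hD2m : StrictMono D2)
    (τ : ℝ) (hτ : 0 ≤ τ) :
    ∃ f : ℝ × ℝ × ℝ, IsEquilibrium D1 D2 dHL dHH dAL dAH n μ τ f := by
  have hq : 0 ≤ dHH / n := div_nonneg hdHH (by linarith)
  let p : ℝ → ℝ × ℝ × ℝ := fun t => (t * dHL, t * (dHH / n), t * dAL)
  let g : ℝ → ℝ := fun t =>
    D1 (F1 dAH n μ (p t)) + τ - D2 (f1max dHL dHH dAL dAH n μ - F1 dAH n μ (p t))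
  have hF : Continuous (fun t => F1 dAH n μ (p t)) := by
    simp only [F1, p]
    fun_prop
  have hg : Continuous g :=
    ((hD1c.comp hF).add continuous_const).sub (hD2c.comp (continuous_const.sub hF))
  have hfeas : ∀ t : ℝ, 0 ≤ t → t ≤ 1 → Feasible dHL dHH dAL n (p t) := fun t h0 h1 =>
    ⟨mul_nonneg h0 hdHL, mul_le_of_le_one_left hdHL h1, mul_nonneg h0 hq,
      mul_le_of_le_one_left hq h1, mul_nonneg h0 hdAL, mul_le_of_le_one_left hdAL h1⟩
  by_cases h0 : 0 ≤ g 0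
  · have h := sub_nonneg.mp h0
    refine ⟨p 0, hfeas 0 le_rfl zero_le_one, ?_, fun _ => h, ?_, fun _ => h, ?_, fun _ => h⟩ <;>
    · intro hc
      simp [p] at hc
  by_cases h1 : g 1 ≤ 0
  · have h := sub_nonpos.mp h1
    refine ⟨p 1, hfeas 1 zero_le_one le_rfl, fun _ => h, ?_, fun _ => h, ?_, fun _ => h, ?_⟩ <;>
    · intro hc
      simp [p] at hc
  push Not at h0 h1
  obtain ⟨t, ht, hgt⟩ := intermediate_value_Icc (zero_le_one (α := ℝ)) hg.continuousOn
    (show (0 : ℝ) ∈ Set.Icc (g 0) (g 1) from ⟨h0.le, h1.le⟩)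
  have h := sub_eq_zero.mp hgt
  exact ⟨p t, hfeas t ht.1 ht.2, fun _ => h.le, fun _ => h.ge, fun _ => h.le, fun _ => h.ge,
    fun _ => h.le, fun _ => h.ge⟩
end
end

section
/- If τ ≥ D2(f1max − f1min) − D1(f1min), then the flow (0, 0, 0) is a lane choice equilibrium, and every lane choice equilibrium equals (0, 0, 0); i.e., the lane choice equilibrium exists and is unique. -/
noncomputable section

theorem equilibrium_unique_high_toll
    (D1 D2 : ℝ → ℝ) (dHL dHH dAL dAH n μ : ℝ)
    (hdHL : 0 ≤ dHL) (hdHH : 0 ≤ dHH) (hdAL : 0 ≤ dAL) (hdAH : 0 ≤ dAH)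
    (hn : 2 ≤ n) (hμ0 : 0 < μ) (hμ1 : μ < 1)
    (hD1c : Continuous D1) (hD1m : StrictMono D1)
    (hD2c : Continuous D2) (hD2m : StrictMono D2)
    (τ : ℝ) (hτ : 0 ≤ τ)
    (hτbig : D2 (f1max dHL dHH dAL dAH n μ - f1min dAH n μ) - D1 (f1min dAH n μ) ≤ τ) :
    IsEquilibrium D1 D2 dHL dHH dAL dAH n μ τ ((0 : ℝ), (0 : ℝ), (0 : ℝ)) ∧
      ∀ f : ℝ × ℝ × ℝ, IsEquilibrium D1 D2 dHL dHH dAL dAH n μ τ f → f = ((0 : ℝ), (0 : ℝ), (0 : ℝ)) := by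
  have h0 : F1 dAH n μ ((0 : ℝ), (0 : ℝ), (0 : ℝ)) = f1min dAH n μ := by
    simp only [F1, f1min]; ring
  have hH : 0 ≤ dHH / n := div_nonneg hdHH (by linarith)
  refine ⟨?_, ?_⟩
  · unfold IsEquilibrium
    rw [h0]
    have key : D2 (f1max dHL dHH dAL dAH n μ - f1min dAH n μ) ≤ D1 (f1min dAH n μ) + τ := by
      linarith
    exact ⟨⟨le_rfl, hdHL, le_rfl, hH, le_rfl, hdAL⟩, fun h => absurd h (lt_irrefl _),
      fun _ => key, fun h => absurd h (lt_irrefl _), fun _ => key,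
      fun h => absurd h (lt_irrefl _), fun _ => key⟩
  · rintro ⟨x, y, z⟩ ⟨⟨hx, -, hy, -, hz, -⟩, ex, -, ey, -, ez, -⟩
    simp only at hx hy hz ex ey ez
    have hF : F1 dAH n μ (x, y, z) = f1min dAH n μ + (x + y + μ * z) := by
      simp only [F1, f1min]; ring
    have hmz : 0 ≤ μ * z := mul_nonneg hμ0.le hz
    have key : 0 < x + y + μ * z →
        ¬ (D1 (F1 dAH n μ (x, y, z)) + τ ≤
          D2 (f1max dHL dHH dAL dAH n μ - F1 dAH n μ (x, y, z))) := by
      intro hp hle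
      have h1 : D1 (f1min dAH n μ) < D1 (F1 dAH n μ (x, y, z)) := hD1m (by linarith)
      have h2 : D2 (f1max dHL dHH dAL dAH n μ - F1 dAH n μ (x, y, z)) <
          D2 (f1max dHL dHH dAL dAH n μ - f1min dAH n μ) := hD2m (by linarith)
      linarith
    have hx0 : x = 0 := by
      by_contra h
      have hp : 0 < x := lt_of_le_of_ne hx (Ne.symm h)
      exact key (by linarith) (ex hp)
    have hy0 : y = 0 := by
      by_contra h
      have hp : 0 < y := lt_of_le_of_ne hy (Ne.symm h)
      exact key (by linarith) (ey hp)
    have hz0 : z = 0 := by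
      by_contra h
      have hp : 0 < z := lt_of_le_of_ne hz (Ne.symm h)
      have := mul_pos hμ0 hp
      exact key (by linarith) (ez hp)
    rw [hx0, hy0, hz0]
end
end

section
/- If D2(0) − D1(f1max) < τ < D2(f1max − f1min) − D1(f1min), then there exists a unique f1* ∈ (f1min, f1max) such that D1(f1*) + τ = D2(f1max − f1*), and a feasible flow f is a lane choice equilibrium if and only if F1(f) = f1*. -/
noncomputable section

theorem equilibrium_characterization_interior_toll
    (D1 D2 : ℝ → ℝ) (dHL dHH dAL dAH n μ : ℝ)
    (hdHL : 0 ≤ dHL) (hdHH : 0 ≤ dHH) (hdAL : 0 ≤ dAL) (hdAH : 0 ≤ dAH)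
    (hn : 2 ≤ n) (hμ0 : 0 < μ) (hμ1 : μ < 1)
    (hD1c : Continuous D1) (hD1m : StrictMono D1)
    (hD2c : Continuous D2) (hD2m : StrictMono D2)
    (τ : ℝ) (hτ : 0 ≤ τ)
    (hlo : D2 0 - D1 (f1max dHL dHH dAL dAH n μ) < τ)
    (hhi : τ < D2 (f1max dHL dHH dAL dAH n μ - f1min dAH n μ) - D1 (f1min dAH n μ)) :
    ∃ f1star : ℝ,
      (f1min dAH n μ < f1star ∧ f1star < f1max dHL dHH dAL dAH n μ ∧
        D1 f1star + τ = D2 (f1max dHL dHH dAL dAH n μ - f1star)) ∧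
      (∀ s : ℝ, f1min dAH n μ < s → s < f1max dHL dHH dAL dAH n μ →
        D1 s + τ = D2 (f1max dHL dHH dAL dAH n μ - s) → s = f1star) ∧
      (∀ f : ℝ × ℝ × ℝ, Feasible dHL dHH dAL n f →
        (IsEquilibrium D1 D2 dHL dHH dAL dAH n μ τ f ↔ F1 dAH n μ f = f1star)) := by
  have hle : f1min dAH n μ ≤ f1max dHL dHH dAL dAH n μ := by
    have h1 : 0 ≤ dHH / n := div_nonneg hdHH (by linarith)
    have h2 : 0 ≤ μ * dAL := mul_nonneg hμ0.le hdAL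
    have h3 : μ * dAH / n = μ * (dAH / n) := mul_div_assoc _ _ _
    unfold f1min f1max
    rw [h3]
    linarith
  have hFmax : ∀ f : ℝ × ℝ × ℝ, f.1 = dHL → f.2.1 = dHH / n → f.2.2 = dAL →
      F1 dAH n μ f = f1max dHL dHH dAL dAH n μ := by
    intro f h1 h2 h3
    unfold F1 f1max
    rw [h1, h2, h3]
  have hFmin : ∀ f : ℝ × ℝ × ℝ, f.1 = 0 → f.2.1 = 0 → f.2.2 = 0 →
      F1 dAH n μ f = f1min dAH n μ := by
    intro f h1 h2 h3
    unfold F1 f1min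
    rw [h1, h2, h3]
    ring
  unfold IsEquilibrium
  generalize f1max dHL dHH dAL dAH n μ = M at *
  generalize f1min dAH n μ = m at *
  have hanti : StrictAnti (fun s => D2 (M - s) - D1 s) := by
    intro a b hab
    have h1 := hD1m hab
    have h2 : D2 (M - b) < D2 (M - a) := hD2m (by linarith)
    show D2 (M - b) - D1 b < D2 (M - a) - D1 a
    linarith
  have hcont : Continuous (fun s => D2 (M - s) - D1 s) := by fun_prop
  have hmem : τ ∈ Set.Ioo ((fun s => D2 (M - s) - D1 s) M) ((fun s => D2 (M - s) - D1 s) m) := by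
    refine ⟨?_, hhi⟩
    simpa using hlo
  obtain ⟨t, ⟨ht1, ht2⟩, ht⟩ := intermediate_value_Ioo' hle hcont.continuousOn hmem
  have huniq : ∀ s : ℝ, D1 s + τ = D2 (M - s) → s = t := by
    intro s hs
    apply hanti.injective
    rw [ht]
    show D2 (M - s) - D1 s = τ
    linarith
  have ht' : D1 t + τ = D2 (M - t) := by
    have : D2 (M - t) - D1 t = τ := ht
    linarith
  refine ⟨t, ⟨ht1, ht2, ht'⟩, fun s _ _ hs => huniq s hs, ?_⟩
  intro f hf
  constructor
  · rintro ⟨_, e1, e2, e3, e4, e5, e6⟩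
    obtain ⟨a1, a2, a3, a4, a5, a6⟩ := hf
    apply huniq
    rcases lt_trichotomy (D1 (F1 dAH n μ f) + τ) (D2 (M - F1 dAH n μ f)) with h | h | h
    · exfalso
      have hF := hFmax f
        (le_antisymm a2 (not_lt.mp fun hc => absurd (e2 hc) (not_le.mpr h)))
        (le_antisymm a4 (not_lt.mp fun hc => absurd (e4 hc) (not_le.mpr h)))
        (le_antisymm a6 (not_lt.mp fun hc => absurd (e6 hc) (not_le.mpr h)))
      rw [hF, sub_self] at h
      linarith
    · exact h
    · exfalso
      have hF := hFmin f
        (le_antisymm (not_lt.mp fun hc => absurd (e1 hc) (not_le.mpr h)) a1)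
        (le_antisymm (not_lt.mp fun hc => absurd (e3 hc) (not_le.mpr h)) a3)
        (le_antisymm (not_lt.mp fun hc => absurd (e5 hc) (not_le.mpr h)) a5)
      rw [hF] at h
      linarith
  · intro h
    rw [h]
    exact ⟨hf, fun _ => ht'.le, fun _ => ht'.ge, fun _ => ht'.le, fun _ => ht'.ge,
      fun _ => ht'.le, fun _ => ht'.ge⟩
end
end

section
/- If D2(0) − D1(f1max) < τ < D2(f1max − f1min) − D1(f1min), and moreover d_HL > 0 and d_AL > 0, then there exist at least two distinct lane choice equilibria (i.e., the lane choice equilibrium is not unique). -/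
noncomputable section

theorem equilibrium_not_unique_interior_toll
    (D1 D2 : ℝ → ℝ) (dHL dHH dAL dAH n μ : ℝ)
    (hdHL : 0 ≤ dHL) (hdHH : 0 ≤ dHH) (hdAL : 0 ≤ dAL) (hdAH : 0 ≤ dAH)
    (hn : 2 ≤ n) (hμ0 : 0 < μ) (hμ1 : μ < 1)
    (hD1c : Continuous D1) (hD1m : StrictMono D1)
    (hD2c : Continuous D2) (hD2m : StrictMono D2)
    (τ : ℝ) (hτ : 0 ≤ τ)
    (hlo : D2 0 - D1 (f1max dHL dHH dAL dAH n μ) < τ)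
    (hhi : τ < D2 (f1max dHL dHH dAL dAH n μ - f1min dAH n μ) - D1 (f1min dAH n μ))
    (hdHLpos : 0 < dHL) (hdALpos : 0 < dAL) :
    ∃ f g : ℝ × ℝ × ℝ, IsEquilibrium D1 D2 dHL dHH dAL dAH n μ τ f ∧ IsEquilibrium D1 D2 dHL dHH dAL dAH n μ τ g ∧ f ≠ g := by
  have hM : f1max dHL dHH dAL dAH n μ = dHL + dHH / n + μ * (dAL + dAH / n) := rfl
  have hm : f1min dAH n μ = μ * (dAH / n) := by unfold f1min; ring
  have hY : 0 ≤ dHH / n := div_nonneg hdHH (by linarith)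
  have key : ∃ t ∈ Set.Ioo (0:ℝ) 1,
      D2 (f1max dHL dHH dAL dAH n μ - (t * (dHL + dHH / n + μ * dAL) + μ * (dAH / n)))
        - D1 (t * (dHL + dHH / n + μ * dAL) + μ * (dAH / n)) = τ := by
    have hc : Continuous (fun t : ℝ =>
        D2 (f1max dHL dHH dAL dAH n μ - (t * (dHL + dHH / n + μ * dAL) + μ * (dAH / n)))
        - D1 (t * (dHL + dHH / n + μ * dAL) + μ * (dAH / n))) := by fun_prop
    have h := intermediate_value_Ioo' (zero_le_one' ℝ) hc.continuousOn
    have hmem := h (show τ ∈ Set.Ioo _ _ from ⟨by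
      have e : 1 * (dHL + dHH / n + μ * dAL) + μ * (dAH / n) = f1max dHL dHH dAL dAH n μ := by
        rw [hM]; ring
      simp only [e, sub_self]; exact hlo, by
      simp only [zero_mul, zero_add]; rw [← hm]; exact hhi⟩)
    obtain ⟨t, ht, h2⟩ := hmem
    exact ⟨t, ht, h2⟩
  obtain ⟨t, ⟨ht0, ht1⟩, ht⟩ := key
  have gen : ∀ f : ℝ × ℝ × ℝ, Feasible dHL dHH dAL n f →
      F1 dAH n μ f = t * (dHL + dHH / n + μ * dAL) + μ * (dAH / n) →
      IsEquilibrium D1 D2 dHL dHH dAL dAH n μ τ f := by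
    intro f hf hF
    unfold IsEquilibrium
    rw [hF]
    refine ⟨hf, ?_, ?_, ?_, ?_, ?_, ?_⟩ <;> intro _ <;> linarith
  have hx0 : 0 < t * dHL := mul_pos ht0 hdHLpos
  have hz0 : 0 < t * dAL := mul_pos ht0 hdALpos
  have hx1 : 0 < (1 - t) * dHL := mul_pos (by linarith) hdHLpos
  have hz1 : 0 < (1 - t) * dAL := mul_pos (by linarith) hdALpos
  have hy0 : 0 ≤ t * (dHH / n) := mul_nonneg ht0.le hY
  have hy1 : 0 ≤ (1 - t) * (dHH / n) := mul_nonneg (by linarith) hY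
  obtain ⟨e, he0, he1, he2⟩ : ∃ e : ℝ, 0 < e ∧ e ≤ t * dAL ∧ μ * e ≤ (1 - t) * dHL := by
    refine ⟨min (t * dAL) ((1 - t) * dHL), lt_min hz0 hx1, min_le_left _ _, ?_⟩
    have h1 := lt_min hz0 hx1
    have h2 := min_le_right (t * dAL) ((1 - t) * dHL)
    nlinarith
  have hμe : 0 < μ * e := mul_pos hμ0 he0
  refine ⟨(t * dHL, t * (dHH / n), t * dAL), (t * dHL + μ * e, t * (dHH / n), t * dAL - e),
    gen _ ?_ ?_, gen _ ?_ ?_, ?_⟩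
  · refine ⟨?_, ?_, ?_, ?_, ?_, ?_⟩ <;> dsimp only <;> linarith
  · unfold F1; ring
  · refine ⟨?_, ?_, ?_, ?_, ?_, ?_⟩ <;> dsimp only <;> linarith
  · unfold F1; ring
  · intro h
    have h1 := congrArg Prod.fst h
    dsimp only at h1
    linarith
end
end

section
/- Assume the interior toll condition and n·μ > 1. Then there exists f⁺ = (x⁺, y⁺, z⁺) ∈ S such that x⁺ = sup{x : (x, y, z) ∈ S} and y⁺ = inf{y : (x, y, z) ∈ S}; and for every such f⁺ and every f ∈ S, J(f) ≤ J(f⁺). -/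
noncomputable section

/-- Total commuter delay. -/
def J (D1 D2 : ℝ → ℝ) (dHL dHH dAL dAH n μ : ℝ) (f : ℝ × ℝ × ℝ) : ℝ :=
  (f.1 + f.2.2 + n * f.2.1 + dAH) * D1 (F1 dAH n μ f) +
  ((dHL - f.1) + (dAL - f.2.2) + n * (dHH / n - f.2.1)) *
    D2 (f1max dHL dHH dAL dAH n μ - F1 dAH n μ f)

theorem worst_equilibrium_nmu_gt_one
    (D1 D2 : ℝ → ℝ) (dHL dHH dAL dAH n μ : ℝ)
    (hdHL : 0 ≤ dHL) (hdHH : 0 ≤ dHH) (hdAL : 0 ≤ dAL) (hdAH : 0 ≤ dAH)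
    (hn : 2 ≤ n) (hμ0 : 0 < μ) (hμ1 : μ < 1)
    (hD1c : Continuous D1) (hD1m : StrictMono D1)
    (hD2c : Continuous D2) (hD2m : StrictMono D2)
    (τ : ℝ) (hτ : 0 ≤ τ)
    (hlo : D2 0 - D1 (f1max dHL dHH dAL dAH n μ) < τ)
    (hhi : τ < D2 (f1max dHL dHH dAL dAH n μ - f1min dAH n μ) - D1 (f1min dAH n μ))
    (hnμ : 1 < n * μ)
    (f1star : ℝ)
    (hstar1 : f1min dAH n μ < f1star) (hstar2 : f1star < f1max dHL dHH dAL dAH n μ)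
    (hstar3 : D1 f1star + τ = D2 (f1max dHL dHH dAL dAH n μ - f1star)) :
    (∃ fp : ℝ × ℝ × ℝ, (Feasible dHL dHH dAL n fp ∧ F1 dAH n μ fp = f1star) ∧
        fp.1 = sSup {x : ℝ | ∃ y z : ℝ, Feasible dHL dHH dAL n (x, y, z) ∧ F1 dAH n μ (x, y, z) = f1star} ∧
        fp.2.1 = sInf {y : ℝ | ∃ x z : ℝ, Feasible dHL dHH dAL n (x, y, z) ∧ F1 dAH n μ (x, y, z) = f1star}) ∧
    ∀ fp : ℝ × ℝ × ℝ, (Feasible dHL dHH dAL n fp ∧ F1 dAH n μ fp = f1star) →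
      fp.1 = sSup {x : ℝ | ∃ y z : ℝ, Feasible dHL dHH dAL n (x, y, z) ∧ F1 dAH n μ (x, y, z) = f1star} →
      fp.2.1 = sInf {y : ℝ | ∃ x z : ℝ, Feasible dHL dHH dAL n (x, y, z) ∧ F1 dAH n μ (x, y, z) = f1star} →
      ∀ f : ℝ × ℝ × ℝ, (Feasible dHL dHH dAL n f ∧ F1 dAH n μ f = f1star) → J D1 D2 dHL dHH dAL dAH n μ f ≤ J D1 D2 dHL dHH dAL dAH n μ fp := by
  have hY : 0 ≤ dHH / n := by positivity
  have hx_bdd : BddAbove {x : ℝ | ∃ y z : ℝ, Feasible dHL dHH dAL n (x, y, z) ∧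
      F1 dAH n μ (x, y, z) = f1star} := by
    refine ⟨dHL, ?_⟩
    rintro x ⟨y, z, h, -⟩
    exact h.2.1
  have hy_bdd : BddBelow {y : ℝ | ∃ x z : ℝ, Feasible dHL dHH dAL n (x, y, z) ∧
      F1 dAH n μ (x, y, z) = f1star} := by
    refine ⟨0, ?_⟩
    rintro y ⟨x, z, h, -⟩
    exact h.2.2.1
  constructor
  · -- greedy choice: fill x first, then z, then y
    have key : ∃ x y z : ℝ, (Feasible dHL dHH dAL n (x, y, z) ∧
        F1 dAH n μ (x, y, z) = f1star) ∧
        (∀ x' y' z' : ℝ, Feasible dHL dHH dAL n (x', y', z') →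
          F1 dAH n μ (x', y', z') = f1star → x' ≤ x ∧ y ≤ y') := by
      simp only [Feasible, F1, f1min, f1max] at *
      have e : μ * dAH / n = μ * (dAH / n) := by ring
      rw [e] at hstar1
      generalize dHH / n = Y at *
      generalize dAH / n = A at *
      by_cases h1 : f1star - μ * A ≤ dHL
      · refine ⟨f1star - μ * A, 0, 0, ⟨⟨by linarith, h1, le_refl _, hY, le_refl _, hdAL⟩,
          by ring⟩, ?_⟩
        rintro x' y' z' ⟨a, b, c, d, e, f⟩ h
        have := mul_nonneg hμ0.le e
        constructor <;> nlinarith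
      · push Not at h1
        by_cases h2 : f1star - μ * A - dHL ≤ μ * dAL
        · refine ⟨dHL, 0, (f1star - μ * A - dHL) / μ, ⟨⟨hdHL, le_refl _, le_refl _, hY,
            div_nonneg (by linarith) hμ0.le, by rw [div_le_iff₀ hμ0]; linarith⟩,
            by field_simp; ring⟩, ?_⟩
          rintro x' y' z' ⟨a, b, c, d, e, f⟩ h
          exact ⟨b, c⟩
        · push Not at h2
          refine ⟨dHL, f1star - μ * A - dHL - μ * dAL, dAL, ⟨⟨hdHL, le_refl _, by linarith,
            by linarith, hdAL, le_refl _⟩, by ring⟩, ?_⟩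
          rintro x' y' z' ⟨a, b, c, d, e, f⟩ h
          have := mul_le_mul_of_nonneg_left f hμ0.le
          exact ⟨b, by linarith⟩
    obtain ⟨x, y, z, hS, hopt⟩ := key
    refine ⟨(x, y, z), hS, ?_, ?_⟩
    · symm
      apply IsGreatest.csSup_eq
      refine ⟨⟨y, z, hS⟩, ?_⟩
      rintro x' ⟨y', z', h, h'⟩
      exact (hopt x' y' z' h h').1
    · symm
      apply IsLeast.csInf_eq
      refine ⟨⟨x, z, hS⟩, ?_⟩
      rintro y' ⟨x', z', h, h'⟩
      exact (hopt x' y' z' h h').2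
  · rintro ⟨xp, yp, zp⟩ ⟨hp, hpF⟩ hsup hinf ⟨x, y, z⟩ ⟨hf, hF⟩
    have hx : x ≤ xp := (le_csSup hx_bdd ⟨y, z, hf, hF⟩).trans_eq hsup.symm
    have hy : yp ≤ y := hinf.trans_le (csInf_le hy_bdd ⟨x, z, hf, hF⟩)
    have hP : xp + zp + n * yp ≤ x + z + n * y := by
      have hE : xp + yp + μ * (zp + dAH / n) = x + y + μ * (z + dAH / n) := hpF.trans hF.symm
      have h1 : 0 ≤ (1 - μ) * (xp - x) := mul_nonneg (by linarith) (by linarith)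
      have h2 : 0 ≤ (n * μ - 1) * (y - yp) := mul_nonneg (by linarith) (by linarith)
      refine le_of_mul_le_mul_left ?_ hμ0
      linarith
    have h3 := mul_le_mul_of_nonneg_left hP hτ
    unfold J
    rw [hpF, hF, ← hstar3]
    dsimp only
    linarith
end
end

section
/- Assume the interior toll condition and n·μ > 1. Then there exists f⁻ = (x⁻, y⁻, z⁻) ∈ S such that x⁻ = inf{x : (x, y, z) ∈ S} and y⁻ = sup{y : (x, y, z) ∈ S}; and for every such f⁻ and every f ∈ S, J(f) ≥ J(f⁻). -/
noncomputable section

theorem best_equilibrium_nmu_gt_one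
    (D1 D2 : ℝ → ℝ) (dHL dHH dAL dAH n μ : ℝ)
    (hdHL : 0 ≤ dHL) (hdHH : 0 ≤ dHH) (hdAL : 0 ≤ dAL) (hdAH : 0 ≤ dAH)
    (hn : 2 ≤ n) (hμ0 : 0 < μ) (hμ1 : μ < 1)
    (hD1c : Continuous D1) (hD1m : StrictMono D1)
    (hD2c : Continuous D2) (hD2m : StrictMono D2)
    (τ : ℝ) (hτ : 0 ≤ τ)
    (hlo : D2 0 - D1 (f1max dHL dHH dAL dAH n μ) < τ)
    (hhi : τ < D2 (f1max dHL dHH dAL dAH n μ - f1min dAH n μ) - D1 (f1min dAH n μ))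
    (hnμ : 1 < n * μ)
    (f1star : ℝ)
    (hstar1 : f1min dAH n μ < f1star) (hstar2 : f1star < f1max dHL dHH dAL dAH n μ)
    (hstar3 : D1 f1star + τ = D2 (f1max dHL dHH dAL dAH n μ - f1star)) :
    (∃ fp : ℝ × ℝ × ℝ, (Feasible dHL dHH dAL n fp ∧ F1 dAH n μ fp = f1star) ∧
        fp.1 = sInf {x : ℝ | ∃ y z : ℝ, Feasible dHL dHH dAL n (x, y, z) ∧ F1 dAH n μ (x, y, z) = f1star} ∧
        fp.2.1 = sSup {y : ℝ | ∃ x z : ℝ, Feasible dHL dHH dAL n (x, y, z) ∧ F1 dAH n μ (x, y, z) = f1star}) ∧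
    ∀ fp : ℝ × ℝ × ℝ, (Feasible dHL dHH dAL n fp ∧ F1 dAH n μ fp = f1star) →
      fp.1 = sInf {x : ℝ | ∃ y z : ℝ, Feasible dHL dHH dAL n (x, y, z) ∧ F1 dAH n μ (x, y, z) = f1star} →
      fp.2.1 = sSup {y : ℝ | ∃ x z : ℝ, Feasible dHL dHH dAL n (x, y, z) ∧ F1 dAH n μ (x, y, z) = f1star} →
      ∀ f : ℝ × ℝ × ℝ, (Feasible dHL dHH dAL n f ∧ F1 dAH n μ f = f1star) → J D1 D2 dHL dHH dAL dAH n μ fp ≤ J D1 D2 dHL dHH dAL dAH n μ f := by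
  have hn0 : (0:ℝ) < n := by linarith
  have hY : 0 ≤ dHH / n := div_nonneg hdHH hn0.le
  constructor
  · have key : ∃ x y z : ℝ, (Feasible dHL dHH dAL n (x, y, z) ∧ F1 dAH n μ (x, y, z) = f1star) ∧
        ∀ x' y' z' : ℝ, Feasible dHL dHH dAL n (x', y', z') →
          F1 dAH n μ (x', y', z') = f1star → x ≤ x' ∧ y' ≤ y := by
      unfold Feasible F1
      unfold f1min at hstar1
      unfold f1max at hstar2
      dsimp only
      rw [mul_div_assoc] at hstar1
      generalize dHH / n = Y at *
      generalize dAH / n = A at *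
      have hμne : μ ≠ 0 := hμ0.ne'
      by_cases h1 : f1star - μ * A ≤ Y
      · refine ⟨0, f1star - μ * A, 0, ⟨⟨le_rfl, hdHL, by linarith, h1, le_rfl, hdAL⟩, by ring⟩, ?_⟩
        rintro x y z ⟨a, b, c, d, e, g⟩ h
        have := mul_nonneg hμ0.le e
        exact ⟨a, by linarith⟩
      · by_cases h2 : f1star - μ * A ≤ Y + μ * dAL
        · refine ⟨0, Y, (f1star - μ * A - Y) / μ, ⟨⟨le_rfl, hdHL, hY, le_rfl,
            div_nonneg (by linarith) hμ0.le, ?_⟩, ?_⟩, ?_⟩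
          · rw [div_le_iff₀ hμ0]; linarith
          · field_simp; ring
          · rintro x y z ⟨a, b, c, d, e, g⟩ h
            exact ⟨a, d⟩
        · refine ⟨f1star - μ * A - Y - μ * dAL, Y, dAL, ⟨⟨by linarith, by linarith, hY, le_rfl,
            hdAL, le_rfl⟩, by ring⟩, ?_⟩
          rintro x y z ⟨a, b, c, d, e, g⟩ h
          have := mul_le_mul_of_nonneg_left g hμ0.le
          exact ⟨by linarith, d⟩
    obtain ⟨x, y, z, hf, hmin⟩ := key
    refine ⟨(x, y, z), hf, ?_, ?_⟩
    · symm
      refine IsLeast.csInf_eq ⟨⟨y, z, hf⟩, ?_⟩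
      rintro x' ⟨y', z', h1, h2⟩
      exact (hmin x' y' z' h1 h2).1
    · symm
      refine IsGreatest.csSup_eq ⟨⟨x, z, hf⟩, ?_⟩
      rintro y' ⟨x', z', h1, h2⟩
      exact (hmin x' y' z' h1 h2).2
  · rintro ⟨x, y, z⟩ ⟨hf, hF⟩ hx hy ⟨x', y', z'⟩ ⟨hf', hF'⟩
    have hxx : x ≤ x' := by
      refine hx.le.trans (csInf_le ⟨0, ?_⟩ ⟨y', z', hf', hF'⟩)
      rintro a ⟨b, c, h, _⟩
      exact h.1
    have hyy : y' ≤ y := by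
      refine le_trans ?_ hy.ge
      refine le_csSup ⟨dHH / n, ?_⟩ ⟨x', z', hf', hF'⟩
      rintro a ⟨b, c, h, _⟩
      exact h.2.2.2.1
    unfold J
    rw [hF, hF', ← hstar3]
    unfold F1 at hF hF'
    dsimp only at hF hF' ⊢
    have hN : x' + z' + n * y' ≤ x + z + n * y := by
      have h1 := mul_nonneg (sub_nonneg.2 hμ1.le) (sub_nonneg.2 hxx)
      have h2 := mul_nonneg (sub_nonneg.2 hnμ.le) (sub_nonneg.2 hyy)
      refine le_of_mul_le_mul_left ?_ hμ0
      linarith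
    have := mul_le_mul_of_nonneg_left hN hτ
    linarith
end
end

section
/- Assume the interior toll condition and n·μ < 1. Then there exists f⁺ = (x⁺, y⁺, z⁺) ∈ S such that x⁺ = sup{x : (x, y, z) ∈ S} and z⁺ = inf{z : (x, y, z) ∈ S}; and for every such f⁺ and every f ∈ S, J(f) ≤ J(f⁺). -/
noncomputable section

theorem worst_equilibrium_nmu_lt_one
    (D1 D2 : ℝ → ℝ) (dHL dHH dAL dAH n μ : ℝ)
    (hdHL : 0 ≤ dHL) (hdHH : 0 ≤ dHH) (hdAL : 0 ≤ dAL) (hdAH : 0 ≤ dAH)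
    (hn : 2 ≤ n) (hμ0 : 0 < μ) (hμ1 : μ < 1)
    (hD1c : Continuous D1) (hD1m : StrictMono D1)
    (hD2c : Continuous D2) (hD2m : StrictMono D2)
    (τ : ℝ) (hτ : 0 ≤ τ)
    (hlo : D2 0 - D1 (f1max dHL dHH dAL dAH n μ) < τ)
    (hhi : τ < D2 (f1max dHL dHH dAL dAH n μ - f1min dAH n μ) - D1 (f1min dAH n μ))
    (hnμ : n * μ < 1)
    (f1star : ℝ)
    (hstar1 : f1min dAH n μ < f1star) (hstar2 : f1star < f1max dHL dHH dAL dAH n μ)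
    (hstar3 : D1 f1star + τ = D2 (f1max dHL dHH dAL dAH n μ - f1star)) :
    (∃ fp : ℝ × ℝ × ℝ, (Feasible dHL dHH dAL n fp ∧ F1 dAH n μ fp = f1star) ∧
        fp.1 = sSup {x : ℝ | ∃ y z : ℝ, Feasible dHL dHH dAL n (x, y, z) ∧ F1 dAH n μ (x, y, z) = f1star} ∧
        fp.2.2 = sInf {z : ℝ | ∃ x y : ℝ, Feasible dHL dHH dAL n (x, y, z) ∧ F1 dAH n μ (x, y, z) = f1star}) ∧
    ∀ fp : ℝ × ℝ × ℝ, (Feasible dHL dHH dAL n fp ∧ F1 dAH n μ fp = f1star) →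
      fp.1 = sSup {x : ℝ | ∃ y z : ℝ, Feasible dHL dHH dAL n (x, y, z) ∧ F1 dAH n μ (x, y, z) = f1star} →
      fp.2.2 = sInf {z : ℝ | ∃ x y : ℝ, Feasible dHL dHH dAL n (x, y, z) ∧ F1 dAH n μ (x, y, z) = f1star} →
      ∀ f : ℝ × ℝ × ℝ, (Feasible dHL dHH dAL n f ∧ F1 dAH n μ f = f1star) → J D1 D2 dHL dHH dAL dAH n μ f ≤ J D1 D2 dHL dHH dAL dAH n μ fp := by
  have hY : 0 ≤ dHH / n := div_nonneg hdHH (by linarith)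
  constructor
  · -- it is enough to find a point of S that dominates in both coordinates
    suffices h : ∃ a b c : ℝ, (Feasible dHL dHH dAL n (a, b, c) ∧ F1 dAH n μ (a, b, c) = f1star) ∧
        ∀ x y z : ℝ, Feasible dHL dHH dAL n (x, y, z) → F1 dAH n μ (x, y, z) = f1star →
          x ≤ a ∧ c ≤ z by
      obtain ⟨a, b, c, hS, hall⟩ := h
      refine ⟨(a, b, c), hS, ?_, ?_⟩
      · symm
        refine IsGreatest.csSup_eq ⟨⟨b, c, hS⟩, ?_⟩
        rintro x ⟨y, z, h1, h2⟩
        exact (hall x y z h1 h2).1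
      · symm
        refine IsLeast.csInf_eq ⟨⟨a, b, hS⟩, ?_⟩
        rintro z ⟨x, y, h1, h2⟩
        exact (hall x y z h1 h2).2
    simp only [Feasible, F1, f1min, f1max] at *
    rw [mul_div_assoc] at hstar1
    generalize dHH / n = Y at *
    generalize dAH / n = A at *
    rcases le_total (f1star - μ * A) dHL with h1 | h1
    · refine ⟨f1star - μ * A, 0, 0, ⟨⟨by linarith, h1, le_rfl, hY, le_rfl, hdAL⟩, by ring⟩, ?_⟩
      rintro x y z ⟨_, _, _, _, hz, _⟩ h
      have := mul_nonneg hμ0.le hz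
      exact ⟨by linarith, hz⟩
    rcases le_total (f1star - μ * A) (dHL + Y) with h2 | h2
    · refine ⟨dHL, f1star - μ * A - dHL, 0,
        ⟨⟨hdHL, le_rfl, by linarith, by linarith, le_rfl, hdAL⟩, by ring⟩, ?_⟩
      rintro x y z ⟨_, hx, _, _, hz, _⟩ h
      exact ⟨hx, hz⟩
    · refine ⟨dHL, Y, (f1star - μ * A - dHL - Y) / μ,
        ⟨⟨hdHL, le_rfl, hY, le_rfl, div_nonneg (by linarith) hμ0.le, ?_⟩, ?_⟩, ?_⟩
      · rw [div_le_iff₀ hμ0]; linarith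
      · field_simp; ring
      · rintro x y z ⟨_, hx, _, hy, _, _⟩ h
        refine ⟨hx, ?_⟩
        rw [div_le_iff₀ hμ0]; linarith
  · rintro ⟨a, b, c⟩ ⟨_, hp⟩ hsup hinf ⟨x, y, z⟩ ⟨hF, hf⟩
    have hxa : x ≤ a := by
      change a = _ at hsup
      rw [hsup]
      refine le_csSup ⟨dHL, ?_⟩ ⟨y, z, hF, hf⟩
      rintro _ ⟨_, _, h, _⟩
      exact h.2.1
    have hcz : c ≤ z := by
      change c = _ at hinf
      rw [hinf]
      refine csInf_le ⟨0, ?_⟩ ⟨x, y, hF, hf⟩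
      rintro _ ⟨_, _, h, _⟩
      exact h.2.2.2.2.1
    unfold J
    rw [hp, hf, ← hstar3]
    simp only [F1] at hp hf
    have hb : b - y = (x - a) + μ * (z - c) := by linarith
    have hW : a + c + n * b ≤ x + z + n * y := by
      have e : (x + z + n * y) - (a + c + n * b) = (n - 1) * (a - x) + (1 - n * μ) * (z - c) := by
        linear_combination (-n) * hb
      have := mul_nonneg (by linarith : 0 ≤ n - 1) (sub_nonneg.2 hxa)
      have := mul_nonneg (by linarith : 0 ≤ 1 - n * μ) (sub_nonneg.2 hcz)
      linarith
    have := mul_le_mul_of_nonneg_left hW hτ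
    dsimp only
    linarith
end
end

section
/- Assume the interior toll condition and n·μ < 1. Then there exists f⁻ = (x⁻, y⁻, z⁻) ∈ S such that x⁻ = inf{x : (x, y, z) ∈ S} and z⁻ = sup{z : (x, y, z) ∈ S}; and for every such f⁻ and every f ∈ S, J(f) ≥ J(f⁻). -/
noncomputable section

theorem best_equilibrium_nmu_lt_one
    (D1 D2 : ℝ → ℝ) (dHL dHH dAL dAH n μ : ℝ)
    (hdHL : 0 ≤ dHL) (hdHH : 0 ≤ dHH) (hdAL : 0 ≤ dAL) (hdAH : 0 ≤ dAH)
    (hn : 2 ≤ n) (hμ0 : 0 < μ) (hμ1 : μ < 1)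
    (hD1c : Continuous D1) (hD1m : StrictMono D1)
    (hD2c : Continuous D2) (hD2m : StrictMono D2)
    (τ : ℝ) (hτ : 0 ≤ τ)
    (hlo : D2 0 - D1 (f1max dHL dHH dAL dAH n μ) < τ)
    (hhi : τ < D2 (f1max dHL dHH dAL dAH n μ - f1min dAH n μ) - D1 (f1min dAH n μ))
    (hnμ : n * μ < 1)
    (f1star : ℝ)
    (hstar1 : f1min dAH n μ < f1star) (hstar2 : f1star < f1max dHL dHH dAL dAH n μ)
    (hstar3 : D1 f1star + τ = D2 (f1max dHL dHH dAL dAH n μ - f1star)) :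
    (∃ fp : ℝ × ℝ × ℝ, (Feasible dHL dHH dAL n fp ∧ F1 dAH n μ fp = f1star) ∧
        fp.1 = sInf {x : ℝ | ∃ y z : ℝ, Feasible dHL dHH dAL n (x, y, z) ∧ F1 dAH n μ (x, y, z) = f1star} ∧
        fp.2.2 = sSup {z : ℝ | ∃ x y : ℝ, Feasible dHL dHH dAL n (x, y, z) ∧ F1 dAH n μ (x, y, z) = f1star}) ∧
    ∀ fp : ℝ × ℝ × ℝ, (Feasible dHL dHH dAL n fp ∧ F1 dAH n μ fp = f1star) →
      fp.1 = sInf {x : ℝ | ∃ y z : ℝ, Feasible dHL dHH dAL n (x, y, z) ∧ F1 dAH n μ (x, y, z) = f1star} →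
      fp.2.2 = sSup {z : ℝ | ∃ x y : ℝ, Feasible dHL dHH dAL n (x, y, z) ∧ F1 dAH n μ (x, y, z) = f1star} →
      ∀ f : ℝ × ℝ × ℝ, (Feasible dHL dHH dAL n f ∧ F1 dAH n μ f = f1star) → J D1 D2 dHL dHH dAL dAH n μ fp ≤ J D1 D2 dHL dHH dAL dAH n μ f := by
  have hn0 : 0 < n := by linarith
  have hY : 0 ≤ dHH / n := div_nonneg hdHH hn0.le
  constructor
  · -- the explicit flow: fill lane 1 by `z` first, then `y`, then `x`
    have hc1 : 0 < f1star - μ * (dAH / n) := by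
      have h : f1min dAH n μ = μ * (dAH / n) := by unfold f1min; ring
      linarith
    have hc2 : f1star - μ * (dAH / n) < dHL + dHH / n + μ * dAL := by
      have h : f1max dHL dHH dAL dAH n μ = dHL + dHH / n + μ * dAL + μ * (dAH / n) := by
        unfold f1max; ring
      linarith
    have key : ∃ x y z : ℝ, Feasible dHL dHH dAL n (x, y, z) ∧ F1 dAH n μ (x, y, z) = f1star ∧
        (∀ x' y' z' : ℝ, Feasible dHL dHH dAL n (x', y', z') →
          F1 dAH n μ (x', y', z') = f1star → x ≤ x' ∧ z' ≤ z) := by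
      simp only [Feasible, F1]
      by_cases h1 : f1star - μ * (dAH / n) ≤ μ * dAL
      · have hz : μ * ((f1star - μ * (dAH / n)) / μ) = f1star - μ * (dAH / n) := by
          field_simp
        refine ⟨0, 0, (f1star - μ * (dAH / n)) / μ,
          ⟨le_rfl, hdHL, le_rfl, hY, by positivity, ?_⟩, ?_, ?_⟩
        · rw [div_le_iff₀ hμ0]; linarith
        · rw [mul_add, hz]; ring
        · rintro x' y' z' ⟨hx, -, hy, -, hz', -⟩ he
          refine ⟨hx, ?_⟩
          rw [le_div_iff₀ hμ0]; linarith
      · push Not at h1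
        by_cases h2 : f1star - μ * (dAH / n) - μ * dAL ≤ dHH / n
        · refine ⟨0, f1star - μ * (dAH / n) - μ * dAL, dAL,
            ⟨le_rfl, hdHL, by linarith, h2, hdAL, le_rfl⟩, by ring, ?_⟩
          rintro x' y' z' ⟨hx, -, -, -, -, hz'⟩ _
          exact ⟨hx, hz'⟩
        · push Not at h2
          refine ⟨f1star - μ * (dAH / n) - μ * dAL - dHH / n, dHH / n, dAL,
            ⟨by linarith, by linarith, hY, le_rfl, hdAL, le_rfl⟩, by ring, ?_⟩
          rintro x' y' z' ⟨-, -, -, hy, -, hz'⟩ he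
          have := mul_le_mul_of_nonneg_left hz' hμ0.le
          exact ⟨by linarith, hz'⟩
    obtain ⟨x, y, z, hf, hF, hopt⟩ := key
    refine ⟨(x, y, z), ⟨hf, hF⟩, ?_, ?_⟩
    · symm; apply IsLeast.csInf_eq; refine ⟨⟨y, z, hf, hF⟩, ?_⟩
      rintro x' ⟨y', z', h, h'⟩
      exact (hopt x' y' z' h h').1
    · symm; apply IsGreatest.csSup_eq; refine ⟨⟨x, y, hf, hF⟩, ?_⟩
      rintro z' ⟨x', y', h, h'⟩
      exact (hopt x' y' z' h h').2
  · rintro ⟨x, y, z⟩ ⟨hf, hF⟩ hx hz ⟨x', y', z'⟩ ⟨hf', hF'⟩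
    have h1 : x ≤ x' := by
      have hx' : x = _ := hx
      rw [hx']
      refine csInf_le ⟨0, ?_⟩ ⟨y', z', hf', hF'⟩
      rintro a ⟨b, c, h, -⟩
      exact h.1
    have h2 : z' ≤ z := by
      have hz' : z = _ := hz
      rw [hz']
      refine le_csSup ⟨dAL, ?_⟩ ⟨x', y', hf', hF'⟩
      rintro a ⟨b, c, h, -⟩
      exact h.2.2.2.2.2
    unfold J
    rw [hF, hF', ← hstar3]
    simp only [F1] at hF hF'
    have hy : y = f1star - x - μ * (z + dAH / n) := by linarith
    have hy' : y' = f1star - x' - μ * (z' + dAH / n) := by linarith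
    have hgain : 0 ≤ (x + z + n * y) - (x' + z' + n * y') := by
      have e : (x + z + n * y) - (x' + z' + n * y')
          = (n - 1) * (x' - x) + (1 - n * μ) * (z - z') := by
        rw [hy, hy']; ring
      rw [e]
      have := mul_nonneg (by linarith : 0 ≤ n - 1) (sub_nonneg.2 h1)
      have := mul_nonneg (by linarith : 0 ≤ 1 - n * μ) (sub_nonneg.2 h2)
      linarith
    have := mul_nonneg hτ hgain
    dsimp only
    linear_combination this
end
end

section
/- Assume the interior toll condition and n·μ = 1. Then every f⁺ = (x⁺, y⁺, z⁺) ∈ S with x⁺ = sup{x : (x, y, z) ∈ S} satisfies J(f) ≤ J(f⁺) for all f ∈ S, and at least one such f⁺ exists in S. -/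
noncomputable section

theorem worst_equilibrium_nmu_eq_one
    (D1 D2 : ℝ → ℝ) (dHL dHH dAL dAH n μ : ℝ)
    (hdHL : 0 ≤ dHL) (hdHH : 0 ≤ dHH) (hdAL : 0 ≤ dAL) (hdAH : 0 ≤ dAH)
    (hn : 2 ≤ n) (hμ0 : 0 < μ) (hμ1 : μ < 1)
    (hD1c : Continuous D1) (hD1m : StrictMono D1)
    (hD2c : Continuous D2) (hD2m : StrictMono D2)
    (τ : ℝ) (hτ : 0 ≤ τ)
    (hlo : D2 0 - D1 (f1max dHL dHH dAL dAH n μ) < τ)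
    (hhi : τ < D2 (f1max dHL dHH dAL dAH n μ - f1min dAH n μ) - D1 (f1min dAH n μ))
    (hnμ : n * μ = 1)
    (f1star : ℝ)
    (hstar1 : f1min dAH n μ < f1star) (hstar2 : f1star < f1max dHL dHH dAL dAH n μ)
    (hstar3 : D1 f1star + τ = D2 (f1max dHL dHH dAL dAH n μ - f1star)) :
    (∃ fp : ℝ × ℝ × ℝ, (Feasible dHL dHH dAL n fp ∧ F1 dAH n μ fp = f1star) ∧
        fp.1 = sSup {x : ℝ | ∃ y z : ℝ, Feasible dHL dHH dAL n (x, y, z) ∧ F1 dAH n μ (x, y, z) = f1star}) ∧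
    ∀ fp : ℝ × ℝ × ℝ, (Feasible dHL dHH dAL n fp ∧ F1 dAH n μ fp = f1star) →
      fp.1 = sSup {x : ℝ | ∃ y z : ℝ, Feasible dHL dHH dAL n (x, y, z) ∧ F1 dAH n μ (x, y, z) = f1star} →
      ∀ f : ℝ × ℝ × ℝ, (Feasible dHL dHH dAL n f ∧ F1 dAH n μ f = f1star) → J D1 D2 dHL dHH dAL dAH n μ f ≤ J D1 D2 dHL dHH dAL dAH n μ fp := by
  have hn0 : 0 < n := by linarith
  have hb : BddAbove {x : ℝ | ∃ y z : ℝ, Feasible dHL dHH dAL n (x, y, z) ∧ F1 dAH n μ (x, y, z) = f1star} := by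
    refine ⟨dHL, ?_⟩
    rintro x ⟨y, z, h, -⟩
    exact h.2.1
  have hmin : f1min dAH n μ = μ * (dAH / n) := by unfold f1min; ring
  rw [hmin] at hstar1
  refine ⟨?_, ?_⟩
  · have hyy : 0 ≤ dHH / n := by positivity
    unfold f1max at hstar2
    obtain ⟨c, hc⟩ : ∃ c, c = μ * (dAH / n) := ⟨_, rfl⟩
    obtain ⟨X, hX⟩ : ∃ X, X = min dHL (f1star - c) := ⟨_, rfl⟩
    obtain ⟨Y, hY⟩ : ∃ Y, Y = min (dHH / n) (f1star - c - X) := ⟨_, rfl⟩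
    have hX1 : X ≤ dHL := hX ▸ min_le_left _ _
    have hX2 : X ≤ f1star - c := hX ▸ min_le_right _ _
    have hX0 : 0 ≤ X := by rw [hX]; exact le_min hdHL (by linarith)
    have hY1 : Y ≤ dHH / n := hY ▸ min_le_left _ _
    have hY2 : Y ≤ f1star - c - X := hY ▸ min_le_right _ _
    have hY0 : 0 ≤ Y := by rw [hY]; exact le_min hyy (by linarith)
    have hup : f1star - c - X - Y ≤ μ * dAL := by
      have h0 : 0 ≤ μ * dAL := by positivity
      rcases min_choice dHL (f1star - c) with h | h <;>
      rcases min_choice (dHH / n) (f1star - c - X) with h' | h' <;>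
      rw [h] at hX <;> rw [h'] at hY <;> linarith
    have hF : Feasible dHL dHH dAL n (X, Y, n * (f1star - c - X - Y)) := by
      refine ⟨hX0, hX1, hY0, hY1, mul_nonneg hn0.le (by linarith), ?_⟩
      calc n * (f1star - c - X - Y) ≤ n * (μ * dAL) := mul_le_mul_of_nonneg_left hup hn0.le
        _ = dAL := by rw [← mul_assoc, hnμ, one_mul]
    have hE : F1 dAH n μ (X, Y, n * (f1star - c - X - Y)) = f1star := by
      simp only [F1]
      linear_combination (f1star - c - X - Y) * hnμ - hc
    refine ⟨_, ⟨hF, hE⟩, ?_⟩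
    refine le_antisymm (le_csSup hb ⟨_, _, hF, hE⟩) (csSup_le ⟨_, _, _, hF, hE⟩ ?_)
    rintro x ⟨y, z, ⟨-, h1, h2, -, h3, -⟩, h⟩
    simp only [F1] at h h1 h2 h3 ⊢
    have : 0 ≤ μ * z := by positivity
    rw [hX]
    exact le_min h1 (by linarith)
  · rintro ⟨x', y', z'⟩ ⟨-, h'⟩ hs ⟨x, y, z⟩ ⟨hf, h⟩
    have hx : x ≤ x' := by
      have := le_csSup hb ⟨y, z, hf, h⟩
      rw [← hs] at this
      exact this
    have hk : 0 ≤ τ * ((n - 1) * (x' - x)) :=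
      mul_nonneg hτ (mul_nonneg (by linarith) (by linarith))
    simp only [J]
    rw [h, h', ← hstar3]
    simp only [F1] at h h'
    have e : (x + z + n * y) - (x' + z' + n * y') = (n - 1) * (x' - x) := by
      linear_combination n * h - n * h' - (z - z') * hnμ
    rw [← e] at hk
    nlinarith [hk]
end
end

section
/- Assume the interior toll condition and n·μ = 1. Then every f⁻ = (x⁻, y⁻, z⁻) ∈ S with x⁻ = inf{x : (x, y, z) ∈ S} satisfies J(f) ≥ J(f⁻) for all f ∈ S, and at least one such f⁻ exists in S. -/
noncomputable section

theorem best_equilibrium_nmu_eq_one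
    (D1 D2 : ℝ → ℝ) (dHL dHH dAL dAH n μ : ℝ)
    (hdHL : 0 ≤ dHL) (hdHH : 0 ≤ dHH) (hdAL : 0 ≤ dAL) (hdAH : 0 ≤ dAH)
    (hn : 2 ≤ n) (hμ0 : 0 < μ) (hμ1 : μ < 1)
    (hD1c : Continuous D1) (hD1m : StrictMono D1)
    (hD2c : Continuous D2) (hD2m : StrictMono D2)
    (τ : ℝ) (hτ : 0 ≤ τ)
    (hlo : D2 0 - D1 (f1max dHL dHH dAL dAH n μ) < τ)
    (hhi : τ < D2 (f1max dHL dHH dAL dAH n μ - f1min dAH n μ) - D1 (f1min dAH n μ))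
    (hnμ : n * μ = 1)
    (f1star : ℝ)
    (hstar1 : f1min dAH n μ < f1star) (hstar2 : f1star < f1max dHL dHH dAL dAH n μ)
    (hstar3 : D1 f1star + τ = D2 (f1max dHL dHH dAL dAH n μ - f1star)) :
    (∃ fp : ℝ × ℝ × ℝ, (Feasible dHL dHH dAL n fp ∧ F1 dAH n μ fp = f1star) ∧
        fp.1 = sInf {x : ℝ | ∃ y z : ℝ, Feasible dHL dHH dAL n (x, y, z) ∧ F1 dAH n μ (x, y, z) = f1star}) ∧
    ∀ fp : ℝ × ℝ × ℝ, (Feasible dHL dHH dAL n fp ∧ F1 dAH n μ fp = f1star) →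
      fp.1 = sInf {x : ℝ | ∃ y z : ℝ, Feasible dHL dHH dAL n (x, y, z) ∧ F1 dAH n μ (x, y, z) = f1star} →
      ∀ f : ℝ × ℝ × ℝ, (Feasible dHL dHH dAL n f ∧ F1 dAH n μ f = f1star) → J D1 D2 dHL dHH dAL dAH n μ fp ≤ J D1 D2 dHL dHH dAL dAH n μ f := by
  have key : ∃ fp : ℝ × ℝ × ℝ, (Feasible dHL dHH dAL n fp ∧ F1 dAH n μ fp = f1star) ∧
      ∀ x ∈ {x : ℝ | ∃ y z : ℝ, Feasible dHL dHH dAL n (x, y, z) ∧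
        F1 dAH n μ (x, y, z) = f1star}, fp.1 ≤ x := by
    have hH : 0 ≤ dHH / n := by positivity
    have hm : μ * (dAH / n) < f1star := by
      have h := hstar1
      unfold f1min at h
      rwa [mul_div_assoc] at h
    have hM : f1star < dHL + dHH / n + μ * (dAL + dAH / n) := hstar2
    simp only [Feasible, F1, Set.mem_ofPred_eq]
    generalize dHH / n = H at *
    generalize dAH / n = A at *
    by_cases h1 : f1star - μ * A ≤ H
    · refine ⟨(0, f1star - μ * A, 0), ⟨⟨by simp, by simpa, ?_, ?_, by simp, by simpa⟩, ?_⟩, ?_⟩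
      · dsimp only; linarith
      · dsimp only; linarith
      · dsimp only; ring
      · rintro x ⟨y, z, h, -⟩
        exact h.1
    · push Not at h1
      by_cases h2 : f1star - μ * A ≤ H + μ * dAL
      · refine ⟨(0, H, (f1star - μ * A - H) / μ),
          ⟨⟨by simp, by simpa, hH, le_refl _, ?_, ?_⟩, ?_⟩, ?_⟩
        · exact div_nonneg (by linarith) hμ0.le
        · show (f1star - μ * A - H) / μ ≤ dAL
          rw [div_le_iff₀ hμ0]; linarith
        · dsimp only; field_simp; ring
        · rintro x ⟨y, z, h, -⟩
          exact h.1
      · push Not at h2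
        refine ⟨(f1star - μ * A - H - μ * dAL, H, dAL),
          ⟨⟨?_, ?_, hH, le_refl _, hdAL, le_refl _⟩, ?_⟩, ?_⟩
        · dsimp only; linarith
        · dsimp only; linarith
        · dsimp only; ring
        · rintro x ⟨y, z, ⟨_, _, _, hy, _, hz⟩, he⟩
          have := mul_le_mul_of_nonneg_left hz hμ0.le
          dsimp only at *
          linarith
  refine ⟨?_, ?_⟩
  · obtain ⟨fp, h, hl⟩ := key
    have hL : IsLeast {x : ℝ | ∃ y z : ℝ, Feasible dHL dHH dAL n (x, y, z) ∧
        F1 dAH n μ (x, y, z) = f1star} fp.1 := ⟨⟨fp.2.1, fp.2.2, h⟩, hl⟩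
    exact ⟨fp, h, hL.csInf_eq.symm⟩
  · rintro ⟨x, y, z⟩ ⟨_, he⟩ hinf ⟨x', y', z'⟩ ⟨hf', he'⟩
    have hx : x ≤ x' := by
      have hb : BddBelow {x : ℝ | ∃ y z : ℝ, Feasible dHL dHH dAL n (x, y, z) ∧
        F1 dAH n μ (x, y, z) = f1star} := ⟨0, by rintro w ⟨_, _, h, _⟩; exact h.1⟩
      have h := csInf_le hb (show x' ∈ _ from ⟨y', z', hf', he'⟩)
      rw [← hinf] at h
      exact h
    unfold J
    rw [he, he', ← hstar3]
    have e : x + y + μ * (z + dAH / n) = x' + y' + μ * (z' + dAH / n) := he.trans he'.symm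
    have e2 : n * x + n * y + z = n * x' + n * y' + z' := by
      linear_combination n * e - (z - z') * hnμ
    dsimp only
    have hp : 0 ≤ (n - 1) * (x' - x) * τ :=
      mul_nonneg (mul_nonneg (by linarith) (by linarith)) hτ
    have e3 : ((x + z + n * y) - (x' + z' + n * y')) = (n - 1) * (x' - x) := by
      linear_combination e2
    have e4 : ((x + z + n * y) - (x' + z' + n * y')) * τ = (n - 1) * (x' - x) * τ := by rw [e3]
    linarith
end
end

section
/- Assume the interior toll condition, so S is nonempty and compact; let x̄ = sup{x : (x, y, z) ∈ S} and ȳ = inf{y : (x, y, z) ∈ S}. Then 0 ≤ f1* − f1min − x̄ − ȳ ≤ μ·d_AL; in particular, setting z* = (f1* − f1min − x̄ − ȳ)/μ, the flow (x̄, ȳ, z*) belongs to S. -/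
noncomputable section

theorem extreme_point_membership
    (D1 D2 : ℝ → ℝ) (dHL dHH dAL dAH n μ : ℝ)
    (hdHL : 0 ≤ dHL) (hdHH : 0 ≤ dHH) (hdAL : 0 ≤ dAL) (hdAH : 0 ≤ dAH)
    (hn : 2 ≤ n) (hμ0 : 0 < μ) (hμ1 : μ < 1)
    (hD1c : Continuous D1) (hD1m : StrictMono D1)
    (hD2c : Continuous D2) (hD2m : StrictMono D2)
    (τ : ℝ) (hτ : 0 ≤ τ)
    (hlo : D2 0 - D1 (f1max dHL dHH dAL dAH n μ) < τ)
    (hhi : τ < D2 (f1max dHL dHH dAL dAH n μ - f1min dAH n μ) - D1 (f1min dAH n μ))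
    (f1star : ℝ)
    (hstar1 : f1min dAH n μ < f1star) (hstar2 : f1star < f1max dHL dHH dAL dAH n μ)
    (hstar3 : D1 f1star + τ = D2 (f1max dHL dHH dAL dAH n μ - f1star))
    (xbar ybar : ℝ)
    (hxbar : xbar = sSup {x : ℝ | ∃ y z : ℝ, Feasible dHL dHH dAL n (x, y, z) ∧ F1 dAH n μ (x, y, z) = f1star})
    (hybar : ybar = sInf {y : ℝ | ∃ x z : ℝ, Feasible dHL dHH dAL n (x, y, z) ∧ F1 dAH n μ (x, y, z) = f1star}) :
    0 ≤ f1star - f1min dAH n μ - xbar - ybar ∧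
    f1star - f1min dAH n μ - xbar - ybar ≤ μ * dAL ∧
    (Feasible dHL dHH dAL n (xbar, ybar, (f1star - f1min dAH n μ - xbar - ybar) / μ) ∧
      F1 dAH n μ (xbar, ybar, (f1star - f1min dAH n μ - xbar - ybar) / μ) = f1star) := by
  have hb : 0 ≤ dHH / n := div_nonneg hdHH (by linarith)
  have hm : 0 ≤ μ * dAL := mul_nonneg hμ0.le hdAL
  obtain ⟨t, ht⟩ : ∃ t, t = f1star - f1min dAH n μ := ⟨_, rfl⟩
  have hmin : f1min dAH n μ = μ * (dAH / n) := by unfold f1min; ring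
  have ht0 : 0 < t := by linarith
  have ht1 : t < dHL + dHH / n + μ * dAL := by
    unfold f1max at hstar2
    linarith
  -- explicit candidates for the two extreme coordinates
  obtain ⟨X, Y, hX0, hXa, hXt, hY0, hYb, hYt, hr0, hr1, hXor, hYor⟩ :
      ∃ X Y : ℝ, 0 ≤ X ∧ X ≤ dHL ∧ X ≤ t ∧ 0 ≤ Y ∧ Y ≤ dHH / n ∧ t - dHL - μ * dAL ≤ Y ∧
        0 ≤ t - X - Y ∧ t - X - Y ≤ μ * dAL ∧ (X = dHL ∨ X = t) ∧
        (Y = 0 ∨ Y = t - dHL - μ * dAL) := by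
    rcases le_total t dHL with h | h
    · exact ⟨t, 0, by linarith, by linarith, by linarith, by linarith, by linarith, by linarith,
        by linarith, by linarith, Or.inr rfl, Or.inl rfl⟩
    · rcases le_total t (dHL + μ * dAL) with h' | h'
      · exact ⟨dHL, 0, by linarith, by linarith, by linarith, by linarith, by linarith,
          by linarith, by linarith, by linarith, Or.inl rfl, Or.inl rfl⟩
      · exact ⟨dHL, t - dHL - μ * dAL, by linarith, by linarith, by linarith, by linarith,
          by linarith, by linarith, by linarith, by linarith, Or.inl rfl, Or.inr rfl⟩
  have hmem : Feasible dHL dHH dAL n (X, Y, (t - X - Y) / μ) ∧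
      F1 dAH n μ (X, Y, (t - X - Y) / μ) = f1star := by
    refine ⟨⟨hX0, hXa, hY0, hYb, div_nonneg hr0 hμ0.le, ?_⟩, ?_⟩
    · show (t - X - Y) / μ ≤ dAL
      rw [div_le_iff₀ hμ0]
      linarith
    · show X + Y + μ * ((t - X - Y) / μ + dAH / n) = f1star
      rw [mul_add, mul_div_cancel₀ _ hμ0.ne']
      linarith
  have hbd : ∀ x y z : ℝ, Feasible dHL dHH dAL n (x, y, z) → F1 dAH n μ (x, y, z) = f1star →
      x ≤ X ∧ Y ≤ y := by
    intro x y z hf hF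
    obtain ⟨h1, h2, h3, h4, h5, h6⟩ := hf
    simp only [F1] at h1 h2 h3 h4 h5 h6 hF
    have h7 : 0 ≤ μ * z := mul_nonneg hμ0.le h5
    have h8 : μ * z ≤ μ * dAL := mul_le_mul_of_nonneg_left h6 hμ0.le
    have h9 : x + y + μ * z = t := by rw [mul_add] at hF; linarith
    constructor
    · rcases hXor with h | h <;> linarith
    · rcases hYor with h | h <;> linarith
  have hx : xbar = X := by
    rw [hxbar]
    refine IsGreatest.csSup_eq ⟨⟨Y, _, hmem⟩, ?_⟩
    rintro x ⟨y, z, hf, hF⟩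
    exact (hbd x y z hf hF).1
  have hy : ybar = Y := by
    rw [hybar]
    refine IsLeast.csInf_eq ⟨⟨X, _, hmem⟩, ?_⟩
    rintro y ⟨x, z, hf, hF⟩
    exact (hbd x y z hf hF).2
  rw [hx, hy, ← ht]
  exact ⟨hr0, hr1, hmem⟩
end
end

section
/- Assume the interior toll condition. Then for any two flows f = (x_f, y_f, z_f) and g = (x_g, y_g, z_g) in S, J(f) − J(g) = [(1 − 1/μ)·(x_f − x_g) + (n − 1/μ)·(y_f − y_g)] · (D1(f1*) − D2(f1max − f1*)); moreover D1(f1*) − D2(f1max − f1*) = −τ ≤ 0. -/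
noncomputable section

theorem total_delay_difference_on_equilibria
    (D1 D2 : ℝ → ℝ) (dHL dHH dAL dAH n μ : ℝ)
    (hdHL : 0 ≤ dHL) (hdHH : 0 ≤ dHH) (hdAL : 0 ≤ dAL) (hdAH : 0 ≤ dAH)
    (hn : 2 ≤ n) (hμ0 : 0 < μ) (hμ1 : μ < 1)
    (hD1c : Continuous D1) (hD1m : StrictMono D1)
    (hD2c : Continuous D2) (hD2m : StrictMono D2)
    (τ : ℝ) (hτ : 0 ≤ τ)
    (hlo : D2 0 - D1 (f1max dHL dHH dAL dAH n μ) < τ)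
    (hhi : τ < D2 (f1max dHL dHH dAL dAH n μ - f1min dAH n μ) - D1 (f1min dAH n μ))
    (f1star : ℝ)
    (hstar1 : f1min dAH n μ < f1star) (hstar2 : f1star < f1max dHL dHH dAL dAH n μ)
    (hstar3 : D1 f1star + τ = D2 (f1max dHL dHH dAL dAH n μ - f1star)) :
    (∀ f g : ℝ × ℝ × ℝ, (Feasible dHL dHH dAL n f ∧ F1 dAH n μ f = f1star) → (Feasible dHL dHH dAL n g ∧ F1 dAH n μ g = f1star) →
      J D1 D2 dHL dHH dAL dAH n μ f - J D1 D2 dHL dHH dAL dAH n μ g =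
        ((1 - 1 / μ) * (f.1 - g.1) + (n - 1 / μ) * (f.2.1 - g.2.1)) *
          (D1 f1star - D2 (f1max dHL dHH dAL dAH n μ - f1star))) ∧
    D1 f1star - D2 (f1max dHL dHH dAL dAH n μ - f1star) = -τ ∧ -τ ≤ 0 := by
  refine ⟨?_, by linarith, by linarith⟩
  rintro ⟨x, y, z⟩ ⟨x', y', z'⟩ ⟨_, hf⟩ ⟨_, hg⟩
  unfold J
  rw [hf, hg]
  simp only [F1] at hf hg
  have hz : z - z' = -(1 / μ) * ((x - x') + (y - y')) := by
    field_simp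
    linarith
  have hz2 : z = z' + -(1 / μ) * ((x - x') + (y - y')) := by linarith
  simp only []
  rw [hz2]
  ring
end
end

section
/- Assume n·μ ≤ 1, the interior toll condition holds for a toll τ* > 0, and f1* ≤ μ·(d_AL + d_AH/n). Let τ⁺ > τ*. Then under the toll vector (τ_HL, τ_HH, τ_AL) = (τ⁺, τ⁺, τ*), the flow f̂ = (0, 0, (f1* − f1min)/μ) is a heterogeneous-toll lane choice equilibrium, every heterogeneous-toll lane choice equilibrium equals f̂, and J(f̂) ≤ J(f) for all f ∈ S. -/
noncomputable section

/-- Lane choice equilibrium under a heterogeneous toll vector `(τHL, τHH, τAL)`. -/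
def IsHetEquilibrium (D1 D2 : ℝ → ℝ) (dHL dHH dAL dAH n μ τHL τHH τAL : ℝ)
    (f : ℝ × ℝ × ℝ) : Prop :=
  Feasible dHL dHH dAL n f ∧
  (0 < f.1 → D1 (F1 dAH n μ f) + τHL ≤ D2 (f1max dHL dHH dAL dAH n μ - F1 dAH n μ f)) ∧
  (f.1 < dHL → D2 (f1max dHL dHH dAL dAH n μ - F1 dAH n μ f) ≤ D1 (F1 dAH n μ f) + τHL) ∧
  (0 < f.2.1 → D1 (F1 dAH n μ f) + τHH ≤ D2 (f1max dHL dHH dAL dAH n μ - F1 dAH n μ f)) ∧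
  (f.2.1 < dHH / n → D2 (f1max dHL dHH dAL dAH n μ - F1 dAH n μ f) ≤ D1 (F1 dAH n μ f) + τHH) ∧
  (0 < f.2.2 → D1 (F1 dAH n μ f) + τAL ≤ D2 (f1max dHL dHH dAL dAH n μ - F1 dAH n μ f)) ∧
  (f.2.2 < dAL → D2 (f1max dHL dHH dAL dAH n μ - F1 dAH n μ f) ≤ D1 (F1 dAH n μ f) + τAL)

theorem heterogeneous_tolls_nmu_le_one_case_a
    (D1 D2 : ℝ → ℝ) (dHL dHH dAL dAH n μ : ℝ)
    (hdHL : 0 ≤ dHL) (hdHH : 0 ≤ dHH) (hdAL : 0 ≤ dAL) (hdAH : 0 ≤ dAH)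
    (hn : 2 ≤ n) (hμ0 : 0 < μ) (hμ1 : μ < 1)
    (hD1c : Continuous D1) (hD1m : StrictMono D1)
    (hD2c : Continuous D2) (hD2m : StrictMono D2)
    (hnμ : n * μ ≤ 1)
    (τstar : ℝ) (hτstar : 0 < τstar)
    (hlo : D2 0 - D1 (f1max dHL dHH dAL dAH n μ) < τstar)
    (hhi : τstar < D2 (f1max dHL dHH dAL dAH n μ - f1min dAH n μ) - D1 (f1min dAH n μ))
    (f1star : ℝ)
    (hstar1 : f1min dAH n μ < f1star) (hstar2 : f1star < f1max dHL dHH dAL dAH n μ)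
    (hstar3 : D1 f1star + τstar = D2 (f1max dHL dHH dAL dAH n μ - f1star))
    (hf1 : f1star ≤ μ * (dAL + dAH / n))
    (τplus : ℝ) (hτplus : τstar < τplus) :
    IsHetEquilibrium D1 D2 dHL dHH dAL dAH n μ τplus τplus τstar ((0 : ℝ), (0 : ℝ), (f1star - f1min dAH n μ) / μ) ∧
    (∀ f : ℝ × ℝ × ℝ, IsHetEquilibrium D1 D2 dHL dHH dAL dAH n μ τplus τplus τstar f → f = ((0 : ℝ), (0 : ℝ), (f1star - f1min dAH n μ) / μ)) ∧
    (∀ f : ℝ × ℝ × ℝ, (Feasible dHL dHH dAL n f ∧ F1 dAH n μ f = f1star) → J D1 D2 dHL dHH dAL dAH n μ ((0 : ℝ), (0 : ℝ), (f1star - f1min dAH n μ) / μ) ≤ J D1 D2 dHL dHH dAL dAH n μ f) := by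
  have hn0 : n ≠ 0 := by linarith
  have hμne : μ ≠ 0 := hμ0.ne'
  obtain ⟨z, hz⟩ : ∃ z, z = (f1star - f1min dAH n μ) / μ := ⟨_, rfl⟩
  rw [← hz]
  have hmin : f1min dAH n μ = μ * (dAH / n) := by unfold f1min; ring
  have hμz : μ * z = f1star - μ * (dAH / n) := by
    rw [hz, hmin]; field_simp
  have hF : F1 dAH n μ ((0 : ℝ), (0 : ℝ), z) = f1star := by
    simp only [F1]; linarith
  rw [hmin] at hstar1
  have hz0 : 0 < z := by
    by_contra h
    have := mul_nonneg hμ0.le (sub_nonneg.2 (not_lt.1 h))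
    linarith
  have hz1 : z ≤ dAL := by
    have : μ * z ≤ μ * dAL := by linarith
    exact le_of_mul_le_mul_left this hμ0
  have hq : 0 ≤ dHH / n := div_nonneg hdHH (by linarith)
  refine ⟨?_, ?_, ?_⟩
  · refine ⟨⟨le_rfl, hdHL, le_rfl, hq, hz0.le, hz1⟩, ?_⟩
    rw [hF, ← hstar3]
    refine ⟨fun h => absurd h (lt_irrefl _), fun _ => by linarith,
      fun h => absurd h (lt_irrefl _), fun _ => by linarith,
      fun _ => le_rfl, fun _ => le_rfl⟩
  · rintro ⟨x, y, w⟩ ⟨⟨hx0, hx1, hy0, hy1, hw0, hw1⟩, h1, h2, h3, h4, h5, h6⟩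
    obtain ⟨F, hFd⟩ : ∃ F, F = F1 dAH n μ (x, y, w) := ⟨_, rfl⟩
    rw [← hFd] at h1 h2 h3 h4 h5 h6
    simp only [F1] at hFd
    dsimp only at hx0 hx1 hy0 hy1 hw0 hw1 h1 h2 h3 h4 h5 h6
    rcases lt_trichotomy F f1star with hlt | heq | hgt
    · exfalso
      have a1 := hD1m hlt
      have a2 := hD2m (sub_lt_sub_left hlt (f1max dHL dHH dAL dAH n μ))
      have hw : w = dAL := by
        by_contra hne
        have := h6 (lt_of_le_of_ne hw1 hne)
        linarith
      rw [hw] at hFd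
      linarith
    · rw [heq, ← hstar3] at h1 h3
      have hx : x = 0 := by
        by_contra hne
        have := h1 (lt_of_le_of_ne hx0 (Ne.symm hne))
        linarith
      have hy : y = 0 := by
        by_contra hne
        have := h3 (lt_of_le_of_ne hy0 (Ne.symm hne))
        linarith
      have hw : w = z := by
        rw [hx, hy] at hFd
        have : μ * w = μ * z := by linarith
        exact mul_left_cancel₀ hμne this
      rw [hx, hy, hw]
    · exfalso
      have a1 := hD1m hgt
      have a2 := hD2m (sub_lt_sub_left hgt (f1max dHL dHH dAL dAH n μ))
      have hx : x = 0 := by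
        by_contra hne
        have := h1 (lt_of_le_of_ne hx0 (Ne.symm hne))
        linarith
      have hy : y = 0 := by
        by_contra hne
        have := h3 (lt_of_le_of_ne hy0 (Ne.symm hne))
        linarith
      have hw : w = 0 := by
        by_contra hne
        have := h5 (lt_of_le_of_ne hw0 (Ne.symm hne))
        linarith
      rw [hx, hy, hw] at hFd
      linarith
  · rintro ⟨x, y, w⟩ ⟨⟨hx0, hx1, hy0, hy1, hw0, hw1⟩, hFf⟩
    dsimp only at hx0 hx1 hy0 hy1 hw0 hw1
    unfold J
    rw [hF, hFf, ← hstar3]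
    simp only [F1] at hFf
    dsimp only
    have key : x + w + n * y ≤ z := by
      have e : μ * (x + w + n * y) ≤ μ * z := by
        have b1 : μ * x ≤ 1 * x := mul_le_mul_of_nonneg_right hμ1.le hx0
        have b2 : n * μ * y ≤ 1 * y := mul_le_mul_of_nonneg_right hnμ hy0
        linarith
      exact le_of_mul_le_mul_left e hμ0
    have := mul_nonneg (sub_nonneg.2 key) hτstar.le
    linarith
end
end

section
/- Assume n·μ ≤ 1, the interior toll condition holds for a toll τ* > 0, and μ·(d_AL + d_AH/n) < f1* ≤ d_HH/n + μ·(d_AL + d_AH/n). Let τ⁺ > τ* and 0 ≤ τ⁻ < τ*. Then under the toll vector (τ_HL, τ_HH, τ_AL) = (τ⁺, τ*, τ⁻), the flow f̂ = (0, f1* − f1min − μ·d_AL, d_AL) is a heterogeneous-toll lane choice equilibrium, every heterogeneous-toll lane choice equilibrium equals f̂, and J(f̂) ≤ J(f) for all f ∈ S. -/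
noncomputable section

theorem heterogeneous_tolls_nmu_le_one_case_b
    (D1 D2 : ℝ → ℝ) (dHL dHH dAL dAH n μ : ℝ)
    (hdHL : 0 ≤ dHL) (hdHH : 0 ≤ dHH) (hdAL : 0 ≤ dAL) (hdAH : 0 ≤ dAH)
    (hn : 2 ≤ n) (hμ0 : 0 < μ) (hμ1 : μ < 1)
    (hD1c : Continuous D1) (hD1m : StrictMono D1)
    (hD2c : Continuous D2) (hD2m : StrictMono D2)
    (hnμ : n * μ ≤ 1)
    (τstar : ℝ) (hτstar : 0 < τstar)
    (hlo : D2 0 - D1 (f1max dHL dHH dAL dAH n μ) < τstar)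
    (hhi : τstar < D2 (f1max dHL dHH dAL dAH n μ - f1min dAH n μ) - D1 (f1min dAH n μ))
    (f1star : ℝ)
    (hstar1 : f1min dAH n μ < f1star) (hstar2 : f1star < f1max dHL dHH dAL dAH n μ)
    (hstar3 : D1 f1star + τstar = D2 (f1max dHL dHH dAL dAH n μ - f1star))
    (hf1a : μ * (dAL + dAH / n) < f1star)
    (hf1b : f1star ≤ dHH / n + μ * (dAL + dAH / n))
    (τplus : ℝ) (hτplus : τstar < τplus)
    (τminus : ℝ) (hτminus0 : 0 ≤ τminus) (hτminus : τminus < τstar) :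
    IsHetEquilibrium D1 D2 dHL dHH dAL dAH n μ τplus τstar τminus ((0 : ℝ), f1star - f1min dAH n μ - μ * dAL, dAL) ∧
    (∀ f : ℝ × ℝ × ℝ, IsHetEquilibrium D1 D2 dHL dHH dAL dAH n μ τplus τstar τminus f → f = ((0 : ℝ), f1star - f1min dAH n μ - μ * dAL, dAL)) ∧
    (∀ f : ℝ × ℝ × ℝ, (Feasible dHL dHH dAL n f ∧ F1 dAH n μ f = f1star) → J D1 D2 dHL dHH dAL dAH n μ ((0 : ℝ), f1star - f1min dAH n μ - μ * dAL, dAL) ≤ J D1 D2 dHL dHH dAL dAH n μ f) := by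
  have hmin : f1min dAH n μ = μ * (dAH / n) := by unfold f1min; ring
  have hF : F1 dAH n μ ((0 : ℝ), f1star - f1min dAH n μ - μ * dAL, dAL) = f1star := by
    rw [hmin]; simp only [F1]; ring
  refine ⟨?_, ?_, ?_⟩
  · unfold IsHetEquilibrium
    rw [hF]
    refine ⟨⟨le_refl _, hdHL, ?_, ?_, hdAL, le_refl _⟩, ?_, ?_, ?_, ?_, ?_, ?_⟩
    · simp only [hmin]; linarith
    · simp only [hmin]; linarith
    · intro h; exact absurd h (lt_irrefl _)
    · intro _; linarith
    · intro _; linarith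
    · intro _; linarith
    · intro _; linarith
    · intro h; exact absurd h (lt_irrefl _)
  · rintro ⟨x, y, z⟩ ⟨⟨hx0, hx1, hy0, hy1, hz0, hz1⟩, h1, h2, h3, h4, h5, h6⟩
    have hFe : F1 dAH n μ (x, y, z) = x + y + μ * (z + dAH / n) := rfl
    generalize F1 dAH n μ (x, y, z) = F at *
    dsimp only at *
    rcases lt_trichotomy F f1star with hlt | heq | hgt
    · exfalso
      have a := hD1m hlt
      have b := hD2m (show f1max dHL dHH dAL dAH n μ - f1star < f1max dHL dHH dAL dAH n μ - F by linarith)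
      have hy : y = dHH / n := le_antisymm hy1 (by by_contra hc; push Not at hc; linarith [h4 hc])
      have hz : z = dAL := le_antisymm hz1 (by by_contra hc; push Not at hc; linarith [h6 hc])
      subst hz
      linarith
    · subst heq
      have hx : x = 0 := le_antisymm (by by_contra hc; push Not at hc; linarith [h1 hc]) hx0
      have hz : z = dAL := le_antisymm hz1 (by by_contra hc; push Not at hc; linarith [h6 hc])
      have hy : y = F - f1min dAH n μ - μ * dAL := by
        rw [hmin, hFe, hx, hz]; ring
      rw [hx, hz, ← hy]
    · exfalso
      have a := hD1m hgt
      have b := hD2m (show f1max dHL dHH dAL dAH n μ - F < f1max dHL dHH dAL dAH n μ - f1star by linarith)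
      have hx : x = 0 := le_antisymm (by by_contra hc; push Not at hc; linarith [h1 hc]) hx0
      have hy : y = 0 := le_antisymm (by by_contra hc; push Not at hc; linarith [h3 hc]) hy0
      have := mul_le_mul_of_nonneg_left hz1 hμ0.le
      linarith
  · rintro ⟨x, y, z⟩ ⟨⟨hx0, hx1, hy0, hy1, hz0, hz1⟩, hf⟩
    unfold J
    rw [hF, hf, ← hstar3]
    have hFe : x + y + μ * (z + dAH / n) = f1star := hf
    dsimp only at *
    rw [hmin, ← hFe]
    generalize D1 _ = d
    have e1 := mul_nonneg hτstar.le (mul_nonneg (sub_nonneg.2 hz1) (sub_nonneg.2 hnμ))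
    have e2 := mul_nonneg hτstar.le (mul_nonneg (show 0 ≤ n - 1 by linarith) hx0)
    generalize dAH / n = q
    generalize dHH / n = r
    linarith
end
end

section
/- Assume n·μ ≤ 1, the interior toll condition holds for a toll τ* > 0, and f1* > d_HH/n + μ·(d_AL + d_AH/n). Let 0 ≤ τ⁻ < τ*. Then under the toll vector (τ_HL, τ_HH, τ_AL) = (τ*, τ⁻, τ⁻), the flow f̂ = (f1* − f1min − d_HH/n − μ·d_AL, d_HH/n, d_AL) is a heterogeneous-toll lane choice equilibrium, every heterogeneous-toll lane choice equilibrium equals f̂, and J(f̂) ≤ J(f) for all f ∈ S. -/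
noncomputable section

theorem heterogeneous_tolls_nmu_le_one_case_c
    (D1 D2 : ℝ → ℝ) (dHL dHH dAL dAH n μ : ℝ)
    (hdHL : 0 ≤ dHL) (hdHH : 0 ≤ dHH) (hdAL : 0 ≤ dAL) (hdAH : 0 ≤ dAH)
    (hn : 2 ≤ n) (hμ0 : 0 < μ) (hμ1 : μ < 1)
    (hD1c : Continuous D1) (hD1m : StrictMono D1)
    (hD2c : Continuous D2) (hD2m : StrictMono D2)
    (hnμ : n * μ ≤ 1)
    (τstar : ℝ) (hτstar : 0 < τstar)
    (hlo : D2 0 - D1 (f1max dHL dHH dAL dAH n μ) < τstar)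
    (hhi : τstar < D2 (f1max dHL dHH dAL dAH n μ - f1min dAH n μ) - D1 (f1min dAH n μ))
    (f1star : ℝ)
    (hstar1 : f1min dAH n μ < f1star) (hstar2 : f1star < f1max dHL dHH dAL dAH n μ)
    (hstar3 : D1 f1star + τstar = D2 (f1max dHL dHH dAL dAH n μ - f1star))
    (hf1 : dHH / n + μ * (dAL + dAH / n) < f1star)
    (τminus : ℝ) (hτminus0 : 0 ≤ τminus) (hτminus : τminus < τstar) :
    IsHetEquilibrium D1 D2 dHL dHH dAL dAH n μ τstar τminus τminus (f1star - f1min dAH n μ - dHH / n - μ * dAL, dHH / n, dAL) ∧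
    (∀ f : ℝ × ℝ × ℝ, IsHetEquilibrium D1 D2 dHL dHH dAL dAH n μ τstar τminus τminus f → f = (f1star - f1min dAH n μ - dHH / n - μ * dAL, dHH / n, dAL)) ∧
    (∀ f : ℝ × ℝ × ℝ, (Feasible dHL dHH dAL n f ∧ F1 dAH n μ f = f1star) → J D1 D2 dHL dHH dAL dAH n μ (f1star - f1min dAH n μ - dHH / n - μ * dAL, dHH / n, dAL) ≤ J D1 D2 dHL dHH dAL dAH n μ f) := by
  have hmin : f1min dAH n μ = μ * (dAH / n) := by unfold f1min; ring
  have hF : F1 dAH n μ (f1star - f1min dAH n μ - dHH / n - μ * dAL, dHH / n, dAL) = f1star := by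
    rw [hmin]; simp only [F1]; ring
  have hHH : 0 ≤ dHH / n := div_nonneg hdHH (by linarith)
  refine ⟨?_, ?_, ?_⟩
  · unfold IsHetEquilibrium
    rw [hF]
    refine ⟨?_, ?_, ?_, ?_, ?_, ?_, ?_⟩
    · rw [hmin]
      unfold f1max at hstar2
      refine ⟨?_, ?_, hHH, le_refl _, hdAL, le_refl _⟩
      · show 0 ≤ f1star - μ * (dAH / n) - dHH / n - μ * dAL
        linarith
      · show f1star - μ * (dAH / n) - dHH / n - μ * dAL ≤ dHL
        linarith
    · intro _; linarith
    · intro _; linarith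
    · intro _; linarith
    · intro h; exact absurd h (lt_irrefl _)
    · intro _; linarith
    · intro h; exact absurd h (lt_irrefl _)
  · rintro ⟨x, y, z⟩ ⟨⟨hx0, hx1, hy0, hy1, hz0, hz1⟩, h1, h2, h3, h4, h5, h6⟩
    have hg : F1 dAH n μ (x, y, z) = x + y + μ * (z + dAH / n) := rfl
    simp only at hx0 hx1 hy0 hy1 hz0 hz1 h1 h2 h3 h4 h5 h6
    generalize F1 dAH n μ (x, y, z) = g at *
    have hzμ : μ * z ≤ μ * dAL := mul_le_mul_of_nonneg_left hz1 hμ0.le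
    have hge : f1star ≤ g := by
      by_contra hlt
      push Not at hlt
      have a1 := hD1m hlt
      have a2 := hD2m (show f1max dHL dHH dAL dAH n μ - f1star
        < f1max dHL dHH dAL dAH n μ - g by linarith)
      have ex : x = dHL := le_antisymm hx1 (by
        by_contra hc; push Not at hc; have := h2 hc; linarith)
      have ey : y = dHH / n := le_antisymm hy1 (by
        by_contra hc; push Not at hc; have := h4 hc; linarith)
      have ez : z = dAL := le_antisymm hz1 (by
        by_contra hc; push Not at hc; have := h6 hc; linarith)
      rw [ex, ey, ez] at hg
      unfold f1max at hstar2
      linarith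
    have hle : g ≤ f1star := by
      by_contra hlt
      push Not at hlt
      have a1 := hD1m hlt
      have a2 := hD2m (show f1max dHL dHH dAL dAH n μ - g
        < f1max dHL dHH dAL dAH n μ - f1star by linarith)
      have ex : x ≤ 0 := by
        by_contra hc; push Not at hc; have := h1 hc; linarith
      linarith
    have hgs : g = f1star := le_antisymm hle hge
    rw [hgs] at h4 h6 hg
    have ey : y = dHH / n := le_antisymm hy1 (by
      by_contra hc; push Not at hc; have := h4 hc; linarith)
    have ez : z = dAL := le_antisymm hz1 (by
      by_contra hc; push Not at hc; have := h6 hc; linarith)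
    have ex : x = f1star - f1min dAH n μ - dHH / n - μ * dAL := by
      rw [hmin, hg, ey, ez]; ring
    rw [← ex, ey, ez]
  · rintro ⟨x, y, z⟩ ⟨⟨hx0, hx1, hy0, hy1, hz0, hz1⟩, hg⟩
    unfold J
    rw [hF, hg, ← hstar3, hmin]
    simp only [F1] at hg hx0 hx1 hy0 hy1 hz0 hz1 ⊢
    have k1 : 0 ≤ (1 - μ) * (dAL - z) := mul_nonneg (by linarith) (by linarith)
    have k2 : 0 ≤ (n - 1) * (dHH / n - y) := mul_nonneg (by linarith) (by linarith)
    have k3 : 0 ≤ τstar * ((1 - μ) * (dAL - z) + (n - 1) * (dHH / n - y)) :=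
      mul_nonneg hτstar.le (by linarith)
    have ex : x = f1star - y - μ * (z + dAH / n) := by linarith
    subst ex
    generalize dHH / n = w at *
    generalize dAH / n = v at *
    generalize D1 f1star = d at *
    clear hg hx0 hx1
    linarith [k3]
end
end

section
/- Assume n·μ > 1, the interior toll condition holds for a toll τ* > 0, and f1* ≤ d_HH/n + μ·d_AH/n. Let τ⁺ > τ*. Then under the toll vector (τ_HL, τ_HH, τ_AL) = (τ⁺, τ*, τ⁺), the flow f̂ = (0, f1* − f1min, 0) is a heterogeneous-toll lane choice equilibrium, every heterogeneous-toll lane choice equilibrium equals f̂, and J(f̂) ≤ J(f) for all f ∈ S. -/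
noncomputable section

theorem heterogeneous_tolls_nmu_gt_one_case_a
    (D1 D2 : ℝ → ℝ) (dHL dHH dAL dAH n μ : ℝ)
    (hdHL : 0 ≤ dHL) (hdHH : 0 ≤ dHH) (hdAL : 0 ≤ dAL) (hdAH : 0 ≤ dAH)
    (hn : 2 ≤ n) (hμ0 : 0 < μ) (hμ1 : μ < 1)
    (hD1c : Continuous D1) (hD1m : StrictMono D1)
    (hD2c : Continuous D2) (hD2m : StrictMono D2)
    (hnμ : 1 < n * μ)
    (τstar : ℝ) (hτstar : 0 < τstar)
    (hlo : D2 0 - D1 (f1max dHL dHH dAL dAH n μ) < τstar)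
    (hhi : τstar < D2 (f1max dHL dHH dAL dAH n μ - f1min dAH n μ) - D1 (f1min dAH n μ))
    (f1star : ℝ)
    (hstar1 : f1min dAH n μ < f1star) (hstar2 : f1star < f1max dHL dHH dAL dAH n μ)
    (hstar3 : D1 f1star + τstar = D2 (f1max dHL dHH dAL dAH n μ - f1star))
    (hf1 : f1star ≤ dHH / n + μ * dAH / n)
    (τplus : ℝ) (hτplus : τstar < τplus) :
    IsHetEquilibrium D1 D2 dHL dHH dAL dAH n μ τplus τstar τplus ((0 : ℝ), f1star - f1min dAH n μ, (0 : ℝ)) ∧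
    (∀ f : ℝ × ℝ × ℝ, IsHetEquilibrium D1 D2 dHL dHH dAL dAH n μ τplus τstar τplus f → f = ((0 : ℝ), f1star - f1min dAH n μ, (0 : ℝ))) ∧
    (∀ f : ℝ × ℝ × ℝ, (Feasible dHL dHH dAL n f ∧ F1 dAH n μ f = f1star) → J D1 D2 dHL dHH dAL dAH n μ ((0 : ℝ), f1star - f1min dAH n μ, (0 : ℝ)) ≤ J D1 D2 dHL dHH dAL dAH n μ f) := by
  have hF : F1 dAH n μ ((0 : ℝ), f1star - f1min dAH n μ, (0 : ℝ)) = f1star := by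
    simp only [F1, f1min]; ring
  have hmin : μ * (dAH / n) = f1min dAH n μ := by
    simp only [f1min]; ring
  have hf1' : f1star ≤ dHH / n + f1min dAH n μ := hf1
  refine ⟨?_, ?_, ?_⟩
  · refine ⟨⟨le_refl _, hdHL, ?_, ?_, le_refl _, hdAL⟩, ?_⟩
    · show 0 ≤ f1star - f1min dAH n μ
      linarith
    · show f1star - f1min dAH n μ ≤ dHH / n
      linarith
    · rw [hF]
      refine ⟨fun h => absurd h (lt_irrefl _), fun _ => by linarith, fun _ => by linarith,
        fun _ => by linarith, fun h => absurd h (lt_irrefl _), fun _ => by linarith⟩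
  · rintro ⟨x, y, z⟩ ⟨⟨hx0, hx1, hy0, hy1, hz0, hz1⟩, h1, -, h3, h4, h5, -⟩
    simp only at hx0 hx1 hy0 hy1 hz0 hz1 h1 h3 h4 h5
    have hFe : F1 dAH n μ (x, y, z) = x + y + μ * z + f1min dAH n μ := by
      simp only [F1, f1min]; ring
    have hμz : 0 ≤ μ * z := mul_nonneg hμ0.le hz0
    generalize F1 dAH n μ (x, y, z) = F at *
    generalize f1max dHL dHH dAL dAH n μ = M at *
    rcases lt_trichotomy F f1star with hlt | heq | hgt
    · exfalso
      have a := hD1m hlt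
      have b : D2 (M - f1star) < D2 (M - F) := hD2m (by linarith)
      have hy : ¬ y < dHH / n := fun h => by linarith [h4 h]
      linarith
    · rw [heq] at h1 h5
      have hx : x = 0 := le_antisymm (not_lt.mp fun h => by linarith [h1 h]) hx0
      have hz : z = 0 := le_antisymm (not_lt.mp fun h => by linarith [h5 h]) hz0
      subst hx hz
      have hy : y = f1star - f1min dAH n μ := by linarith
      rw [hy]
    · exfalso
      have a := hD1m hgt
      have b : D2 (M - F) < D2 (M - f1star) := hD2m (by linarith)
      have hx : x = 0 := le_antisymm (not_lt.mp fun h => by linarith [h1 h]) hx0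
      have hy : y = 0 := le_antisymm (not_lt.mp fun h => by linarith [h3 h]) hy0
      have hz : z = 0 := le_antisymm (not_lt.mp fun h => by linarith [h5 h]) hz0
      subst hx hy hz
      linarith
  · rintro ⟨x, y, z⟩ ⟨⟨hx0, hx1, hy0, hy1, hz0, hz1⟩, hFf⟩
    simp only at hx0 hx1 hy0 hy1 hz0 hz1
    have hFe : F1 dAH n μ (x, y, z) = x + y + μ * z + f1min dAH n μ := by
      simp only [F1, f1min]; ring
    have hy : f1star - f1min dAH n μ = x + y + μ * z := by linarith
    simp only [J]
    rw [hF, hFf, ← hstar3, hy]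
    have e1 : 0 ≤ (n - 1) * x := mul_nonneg (by linarith) hx0
    have e2 : 0 ≤ (n * μ - 1) * z := mul_nonneg (by linarith) hz0
    have e3 : 0 ≤ ((n - 1) * x + (n * μ - 1) * z) * τstar :=
      mul_nonneg (by linarith) hτstar.le
    linarith [e3]
end
end

section
/- Assume n·μ > 1, the interior toll condition holds for a toll τ* > 0, and d_HH/n + μ·d_AH/n < f1* ≤ d_HH/n + μ·(d_AL + d_AH/n). Let τ⁺ > τ* and 0 ≤ τ⁻ < τ*. Then under the toll vector (τ_HL, τ_HH, τ_AL) = (τ⁺, τ⁻, τ*), the flow f̂ = (0, d_HH/n, (f1* − f1min − d_HH/n)/μ) is a heterogeneous-toll lane choice equilibrium, every heterogeneous-toll lane choice equilibrium equals f̂, and J(f̂) ≤ J(f) for all f ∈ S. -/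
noncomputable section

theorem heterogeneous_tolls_nmu_gt_one_case_b
    (D1 D2 : ℝ → ℝ) (dHL dHH dAL dAH n μ : ℝ)
    (hdHL : 0 ≤ dHL) (hdHH : 0 ≤ dHH) (hdAL : 0 ≤ dAL) (hdAH : 0 ≤ dAH)
    (hn : 2 ≤ n) (hμ0 : 0 < μ) (hμ1 : μ < 1)
    (hD1c : Continuous D1) (hD1m : StrictMono D1)
    (hD2c : Continuous D2) (hD2m : StrictMono D2)
    (hnμ : 1 < n * μ)
    (τstar : ℝ) (hτstar : 0 < τstar)
    (hlo : D2 0 - D1 (f1max dHL dHH dAL dAH n μ) < τstar)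
    (hhi : τstar < D2 (f1max dHL dHH dAL dAH n μ - f1min dAH n μ) - D1 (f1min dAH n μ))
    (f1star : ℝ)
    (hstar1 : f1min dAH n μ < f1star) (hstar2 : f1star < f1max dHL dHH dAL dAH n μ)
    (hstar3 : D1 f1star + τstar = D2 (f1max dHL dHH dAL dAH n μ - f1star))
    (hf1a : dHH / n + μ * dAH / n < f1star)
    (hf1b : f1star ≤ dHH / n + μ * (dAL + dAH / n))
    (τplus : ℝ) (hτplus : τstar < τplus)
    (τminus : ℝ) (hτminus0 : 0 ≤ τminus) (hτminus : τminus < τstar) :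
    IsHetEquilibrium D1 D2 dHL dHH dAL dAH n μ τplus τminus τstar ((0 : ℝ), dHH / n, (f1star - f1min dAH n μ - dHH / n) / μ) ∧
    (∀ f : ℝ × ℝ × ℝ, IsHetEquilibrium D1 D2 dHL dHH dAL dAH n μ τplus τminus τstar f → f = ((0 : ℝ), dHH / n, (f1star - f1min dAH n μ - dHH / n) / μ)) ∧
    (∀ f : ℝ × ℝ × ℝ, (Feasible dHL dHH dAL n f ∧ F1 dAH n μ f = f1star) → J D1 D2 dHL dHH dAL dAH n μ ((0 : ℝ), dHH / n, (f1star - f1min dAH n μ - dHH / n) / μ) ≤ J D1 D2 dHL dHH dAL dAH n μ f) := by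
  have hn0 : 0 < n := by linarith
  have hY : 0 ≤ dHH / n := div_nonneg hdHH hn0.le
  have hmd : μ * dAH / n = μ * (dAH / n) := by ring
  have hmin : f1min dAH n μ = μ * (dAH / n) := by unfold f1min; ring
  rw [hmd] at hf1a
  rw [hmin] at hstar1 ⊢
  obtain ⟨zh, hzh⟩ : ∃ zh, zh = (f1star - μ * (dAH / n) - dHH / n) / μ := ⟨_, rfl⟩
  rw [← hzh]
  have hμz : μ * zh = f1star - μ * (dAH / n) - dHH / n := by
    rw [hzh]; field_simp
  have hz0 : 0 < zh := by
    rw [hzh]; apply div_pos _ hμ0; linarith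
  have hz1 : zh ≤ dAL := by
    refine le_of_mul_le_mul_left ?_ hμ0
    linarith
  have hF : F1 dAH n μ ((0 : ℝ), dHH / n, zh) = f1star := by
    simp only [F1]; linarith
  refine ⟨?_, ?_, ?_⟩
  · refine ⟨⟨le_refl _, hdHL, hY, le_refl _, hz0.le, hz1⟩, ?_⟩
    rw [hF]
    refine ⟨fun h => absurd h (lt_irrefl _), fun _ => by linarith, fun _ => by linarith,
      fun h => absurd h (lt_irrefl _), fun _ => hstar3.le, fun _ => hstar3.ge⟩
  · rintro ⟨x, y, z⟩ ⟨⟨hx0, hx1, hy0, hy1, hzz0, hzz1⟩, h1, h2, h3, h4, h5, h6⟩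
    simp only at hx0 hx1 hy0 hy1 hzz0 hzz1 h1 h2 h3 h4 h5 h6
    have hFe : F1 dAH n μ (x, y, z) = x + y + μ * (z + dAH / n) := rfl
    generalize F1 dAH n μ (x, y, z) = F at *
    rcases lt_trichotomy F f1star with hlt | heq | hgt
    · exfalso
      have a1 := hD1m hlt
      have a2 := hD2m (show f1max dHL dHH dAL dAH n μ - f1star < f1max dHL dHH dAL dAH n μ - F by
        linarith)
      have b1 : dHH / n ≤ y := by
        by_contra hc
        have := h4 (not_le.mp hc)
        linarith
      have b2 : dAL ≤ z := by
        by_contra hc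
        have := h6 (not_le.mp hc)
        linarith
      have := mul_le_mul_of_nonneg_left b2 hμ0.le
      linarith
    · rw [heq] at h1 h4
      have b1 : dHH / n ≤ y := by
        by_contra hc
        have := h4 (not_le.mp hc)
        linarith
      have b2 : x ≤ 0 := by
        by_contra hc
        have := h1 (not_le.mp hc)
        linarith
      have ex : x = 0 := le_antisymm b2 hx0
      have ey : y = dHH / n := le_antisymm hy1 b1
      have ez : z = zh := by
        apply mul_left_cancel₀ hμ0.ne'
        linarith
      rw [ex, ey, ez]
    · exfalso
      have a1 := hD1m hgt
      have a2 := hD2m (show f1max dHL dHH dAL dAH n μ - F < f1max dHL dHH dAL dAH n μ - f1star by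
        linarith)
      have b1 : x ≤ 0 := by
        by_contra hc
        have := h1 (not_le.mp hc)
        linarith
      have b2 : z ≤ 0 := by
        by_contra hc
        have := h5 (not_le.mp hc)
        linarith
      have := mul_le_mul_of_nonneg_left b2 hμ0.le
      linarith
  · rintro ⟨x, y, z⟩ ⟨⟨hx0, hx1, hy0, hy1, hzz0, hzz1⟩, hFf⟩
    simp only at hx0 hx1 hy0 hy1 hzz0 hzz1
    have hFe : F1 dAH n μ (x, y, z) = x + y + μ * (z + dAH / n) := rfl
    unfold J
    rw [hF, hFf, ← hstar3]
    simp only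
    have key : x + z + n * y ≤ zh + n * (dHH / n) := by
      refine le_of_mul_le_mul_left ?_ hμ0
      have c1 : 0 ≤ (n * μ - 1) * (dHH / n - y) :=
        mul_nonneg (by linarith) (by linarith)
      have c2 : 0 ≤ (1 - μ) * x := mul_nonneg (by linarith) hx0
      rw [hFf] at hFe
      linarith
    have c3 := mul_le_mul_of_nonneg_right key hτstar.le
    linarith
end
end

section
/- Assume n·μ > 1, the interior toll condition holds for a toll τ* > 0, and f1* > d_HH/n + μ·(d_AL + d_AH/n). Let 0 ≤ τ⁻ < τ*. Then under the toll vector (τ_HL, τ_HH, τ_AL) = (τ*, τ⁻, τ⁻), the flow f̂ = (f1* − f1min − d_HH/n − μ·d_AL, d_HH/n, d_AL) is a heterogeneous-toll lane choice equilibrium, every heterogeneous-toll lane choice equilibrium equals f̂, and J(f̂) ≤ J(f) for all f ∈ S. -/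
noncomputable section

theorem heterogeneous_tolls_nmu_gt_one_case_c
    (D1 D2 : ℝ → ℝ) (dHL dHH dAL dAH n μ : ℝ)
    (hdHL : 0 ≤ dHL) (hdHH : 0 ≤ dHH) (hdAL : 0 ≤ dAL) (hdAH : 0 ≤ dAH)
    (hn : 2 ≤ n) (hμ0 : 0 < μ) (hμ1 : μ < 1)
    (hD1c : Continuous D1) (hD1m : StrictMono D1)
    (hD2c : Continuous D2) (hD2m : StrictMono D2)
    (hnμ : 1 < n * μ)
    (τstar : ℝ) (hτstar : 0 < τstar)
    (hlo : D2 0 - D1 (f1max dHL dHH dAL dAH n μ) < τstar)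
    (hhi : τstar < D2 (f1max dHL dHH dAL dAH n μ - f1min dAH n μ) - D1 (f1min dAH n μ))
    (f1star : ℝ)
    (hstar1 : f1min dAH n μ < f1star) (hstar2 : f1star < f1max dHL dHH dAL dAH n μ)
    (hstar3 : D1 f1star + τstar = D2 (f1max dHL dHH dAL dAH n μ - f1star))
    (hf1 : dHH / n + μ * (dAL + dAH / n) < f1star)
    (τminus : ℝ) (hτminus0 : 0 ≤ τminus) (hτminus : τminus < τstar) :
    IsHetEquilibrium D1 D2 dHL dHH dAL dAH n μ τstar τminus τminus (f1star - f1min dAH n μ - dHH / n - μ * dAL, dHH / n, dAL) ∧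
    (∀ f : ℝ × ℝ × ℝ, IsHetEquilibrium D1 D2 dHL dHH dAL dAH n μ τstar τminus τminus f → f = (f1star - f1min dAH n μ - dHH / n - μ * dAL, dHH / n, dAL)) ∧
    (∀ f : ℝ × ℝ × ℝ, (Feasible dHL dHH dAL n f ∧ F1 dAH n μ f = f1star) → J D1 D2 dHL dHH dAL dAH n μ (f1star - f1min dAH n μ - dHH / n - μ * dAL, dHH / n, dAL) ≤ J D1 D2 dHL dHH dAL dAH n μ f) := by

  have hmin : f1min dAH n μ = μ * (dAH / n) := by unfold f1min; ring
  have hF : F1 dAH n μ (f1star - f1min dAH n μ - dHH / n - μ * dAL, dHH / n, dAL) = f1star := by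
    rw [hmin]; simp only [F1]; ring
  have hmax : f1max dHL dHH dAL dAH n μ = dHL + dHH / n + μ * dAL + μ * (dAH / n) := by
    unfold f1max; ring
  have hy0 : 0 ≤ dHH / n := by positivity
  have hf1' : dHH / n + μ * dAL + μ * (dAH / n) < f1star := by linarith
  refine ⟨?_, ?_, ?_⟩
  · refine ⟨?_, ?_⟩
    · simp only [Feasible]
      rw [hmin]
      refine ⟨by linarith, by linarith, hy0, le_rfl, hdAL, le_rfl⟩
    · rw [hF, ← hstar3]
      refine ⟨fun _ => le_rfl, fun _ => le_rfl, fun _ => by linarith,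
        fun h => absurd h (lt_irrefl _), fun _ => by linarith, fun h => absurd h (lt_irrefl _)⟩
  · rintro ⟨x, y, z⟩ ⟨⟨h1, h2, h3, h4, h5, h6⟩, e1, e2, e3, e4, e5, e6⟩
    simp only at h1 h2 h3 h4 h5 h6 e1 e2 e3 e4 e5 e6
    have hFv : F1 dAH n μ (x, y, z) = x + y + μ * z + μ * (dAH / n) := by
      simp only [F1]; ring
    have hμz : μ * z ≤ μ * dAL := mul_le_mul_of_nonneg_left h6 hμ0.le
    generalize F1 dAH n μ (x, y, z) = F at *
    rcases lt_trichotomy F f1star with h | h | h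
    · have k1 := hD1m h
      have k2 : D2 (f1max dHL dHH dAL dAH n μ - f1star) < D2 (f1max dHL dHH dAL dAH n μ - F) :=
        hD2m (by linarith)
      have a1 : x = dHL := by
        by_contra hne
        linarith [e2 (lt_of_le_of_ne h2 hne)]
      have a2 : y = dHH / n := by
        by_contra hne
        linarith [e4 (lt_of_le_of_ne h4 hne)]
      have a3 : z = dAL := by
        by_contra hne
        linarith [e6 (lt_of_le_of_ne h6 hne)]
      subst a3
      linarith
    · subst h
      have a2 : y = dHH / n := by
        by_contra hne
        linarith [e4 (lt_of_le_of_ne h4 hne)]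
      have a3 : z = dAL := by
        by_contra hne
        linarith [e6 (lt_of_le_of_ne h6 hne)]
      have a1 : x = F - f1min dAH n μ - dHH / n - μ * dAL := by
        rw [hmin, ← a2, ← a3]; linarith
      rw [← a1, ← a2, ← a3]
    · have k1 := hD1m h
      have k2 : D2 (f1max dHL dHH dAL dAH n μ - F) < D2 (f1max dHL dHH dAL dAH n μ - f1star) :=
        hD2m (by linarith)
      have a1 : x = 0 := by
        by_contra hne
        linarith [e1 (lt_of_le_of_ne h1 (Ne.symm hne))]
      linarith
  · rintro ⟨x, y, z⟩ ⟨⟨h1, h2, h3, h4, h5, h6⟩, hFf⟩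
    simp only at h1 h2 h3 h4 h5 h6
    have hFv : x + y + μ * z + μ * (dAH / n) = f1star := by
      rw [← hFf]; simp only [F1]; ring
    unfold J
    rw [hF, hFf, ← hstar3, hmin]
    simp only
    have hx : x = f1star - y - μ * z - μ * (dAH / n) := by linarith
    have g1 : 0 ≤ (n - 1) * (dHH / n - y) := mul_nonneg (by linarith) (by linarith)
    have g2 : 0 ≤ (1 - μ) * (dAL - z) := mul_nonneg (by linarith) (by linarith)
    have g3 := mul_nonneg hτstar.le (add_nonneg g1 g2)
    rw [hx]
    generalize dHH / n = Y at *
    generalize dAH / n = W at *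
    linarith
end
end
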